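/- arXiv:1003.0930 — 5 statements merged into one kernel-verified Lean document; each statement's English description precedes it below -/
import Mathlib

section
/- Let n > m ≥ 2 be integers and A ⊆ {0,1,…,n−1} × {0,1,…,m−1} a non-empty set. Then the Assouad dimension of the Bedford–McMullen carpet S(A) equals log_m(s) + log_n(t). -/
open Set Metric Filter

/-- The Assouad dimension of a set `E` in a metric space: the infimum of all `α ≥ 0`
for which there is `C > 0` such that for every `x ∈ E` and all radii `0 < r ≤ R`,
the set `E ∩ B(x, R)` can be covered by at most `C · (R / r) ^ α` balls of radius `r`. -/
noncomputable def assouadDim {X : Type*} [PseudoMetricSpace X] (E : Set X) : ℝ :=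
  sInf { α : ℝ | 0 ≤ α ∧ ∃ C : ℝ, 0 < C ∧ ∀ x ∈ E, ∀ r R : ℝ, 0 < r → r ≤ R →
    ∃ F : Finset X, (F.card : ℝ) ≤ C * (R / r) ^ α ∧
      E ∩ Metric.ball x R ⊆ ⋃ y ∈ F, Metric.ball y r }

/-- The Bedford–McMullen carpet `S(A)` determined by integers `n, m` and
`A ⊆ {0,…,n−1} × {0,…,m−1}`, as a subset of the Euclidean plane. -/
def bmCarpet (n m : ℕ) (A : Finset (ℕ × ℕ)) : Set (EuclideanSpace ℝ (Fin 2)) :=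
  { z | ∃ x y : ℕ → ℕ, (∀ i, (x i, y i) ∈ A) ∧
      z 0 = ∑' i : ℕ, (x i : ℝ) / (n : ℝ) ^ (i + 1) ∧
      z 1 = ∑' i : ℕ, (y i : ℝ) / (m : ℝ) ^ (i + 1) }

/-- `t_j`: the number of elements `(i, j)` of `A` in row `j`. -/
def rowCount (A : Finset (ℕ × ℕ)) (j : ℕ) : ℕ := (A.filter (fun p => p.2 = j)).card

/-- `s`: the number of non-empty rows. -/
def sVal (m : ℕ) (A : Finset (ℕ × ℕ)) : ℕ :=
  ((Finset.range m).filter (fun j => rowCount A j ≠ 0)).card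

/-- `t`: the maximal number of entries in a row. -/
def tVal (m : ℕ) (A : Finset (ℕ × ℕ)) : ℕ :=
  (Finset.range m).sup (fun j => rowCount A j)

/-- The real number in `[0, 1]` with base-`b` digits `x 0, x 1, …`. -/
noncomputable def digitVal (b : ℕ) (x : ℕ → ℕ) : ℝ :=
  ∑' i : ℕ, (x i : ℝ) / (b : ℝ) ^ (i + 1)

/-- The integer whose base-`b` digits are `x 0, …, x (k - 1)`, most significant first. -/
def digitTrunc (b : ℕ) (x : ℕ → ℕ) : ℕ → ℕ
  | 0 => 0
  | k + 1 => b * digitTrunc b x k + x k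

theorem eq_of_digitTrunc_eq {b : ℕ} {x y : ℕ → ℕ} (hx : ∀ i, x i < b) (hy : ∀ i, y i < b) :
    ∀ k, digitTrunc b x k = digitTrunc b y k → ∀ i < k, x i = y i := by
  intro k
  induction k with
  | zero => intro _ i hi; omega
  | succ k ih =>
    intro h i hi
    simp only [digitTrunc] at h
    have hb : 0 < b := (Nat.zero_le _).trans_lt (hx 0)
    have h1 : x k = y k := by
      have := congrArg (· % b) h
      simpa [Nat.mul_add_mod, Nat.mod_eq_of_lt (hx k), Nat.mod_eq_of_lt (hy k)] using this
    have h2 : digitTrunc b x k = digitTrunc b y k := by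
      rw [h1] at h
      exact Nat.eq_of_mul_eq_mul_left hb (Nat.add_right_cancel h)
    rcases Nat.lt_succ_iff_lt_or_eq.mp hi with h3 | rfl
    · exact ih h2 i h3
    · exact h1

theorem digitTrunc_congr {b : ℕ} {x y : ℕ → ℕ} :
    ∀ k, (∀ i < k, x i = y i) → digitTrunc b x k = digitTrunc b y k := by
  intro k
  induction k with
  | zero => intro _; rfl
  | succ k ih =>
    intro h
    simp only [digitTrunc]
    rw [ih fun i hi => h i (by omega), h k (by omega)]

theorem hasSum_max_digits {b : ℕ} (hb : 2 ≤ b) :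
    HasSum (fun i : ℕ => ((b : ℝ) - 1) / (b : ℝ) ^ (i + 1)) 1 := by
  have hb' : (2 : ℝ) ≤ b := by exact_mod_cast hb
  have h := (hasSum_geometric_of_lt_one (r := (b : ℝ)⁻¹) (by positivity)
    (inv_lt_one_of_one_lt₀ (by linarith))).mul_left (((b : ℝ) - 1) / b)
  have h0 : (b : ℝ) - 1 ≠ 0 := by linarith
  have h1 : ((b : ℝ) - 1) / b * (1 - (b : ℝ)⁻¹)⁻¹ = 1 := by
    have : 1 - (b : ℝ)⁻¹ = ((b : ℝ) - 1) / b := by field_simp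
    rw [this]
    field_simp
  rw [h1] at h
  have h2 : (fun i : ℕ => ((b : ℝ) - 1) / (b : ℝ) ^ (i + 1)) =
      fun i => ((b : ℝ) - 1) / b * (b : ℝ)⁻¹ ^ i := by
    funext i
    rw [pow_succ, inv_pow]
    field_simp
  rwa [h2]

theorem max_digit_bound {b : ℕ} {x : ℕ → ℕ} (hx : ∀ i, x i < b) (i : ℕ) :
    (x i : ℝ) / (b : ℝ) ^ (i + 1) ≤ ((b : ℝ) - 1) / (b : ℝ) ^ (i + 1) := by
  have : (x i : ℝ) + 1 ≤ b := by exact_mod_cast hx i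
  gcongr
  linarith

theorem summable_digits {b : ℕ} (hb : 2 ≤ b) {x : ℕ → ℕ} (hx : ∀ i, x i < b) :
    Summable fun i : ℕ => (x i : ℝ) / (b : ℝ) ^ (i + 1) :=
  .of_nonneg_of_le (fun _ => by positivity) (max_digit_bound hx) (hasSum_max_digits hb).summable

theorem digitVal_nonneg (b : ℕ) (x : ℕ → ℕ) : 0 ≤ digitVal b x :=
  tsum_nonneg fun _ => by positivity

theorem digitVal_le_one {b : ℕ} (hb : 2 ≤ b) {x : ℕ → ℕ} (hx : ∀ i, x i < b) :
    digitVal b x ≤ 1 :=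
  ((summable_digits hb hx).tsum_le_tsum (max_digit_bound hx)
    (hasSum_max_digits hb).summable).trans (hasSum_max_digits hb).tsum_eq.le

theorem mul_digitVal {b : ℕ} (hb : 2 ≤ b) {x : ℕ → ℕ} (hx : ∀ i, x i < b) :
    b * digitVal b x = x 0 + digitVal b fun i => x (i + 1) := by
  have hb' : (b : ℝ) ≠ 0 := by positivity
  unfold digitVal
  rw [(summable_digits hb hx).tsum_eq_zero_add, mul_add, ← tsum_mul_left]
  congr 1
  · rw [zero_add, pow_one]
    field_simp
  · refine tsum_congr fun i => ?_
    rw [pow_succ _ (i + 1)]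
    field_simp

theorem pow_mul_digitVal {b : ℕ} (hb : 2 ≤ b) {x : ℕ → ℕ} (hx : ∀ i, x i < b) (k : ℕ) :
    (b : ℝ) ^ k * digitVal b x = digitTrunc b x k + digitVal b fun i => x (i + k) := by
  induction k with
  | zero => simp [digitTrunc]
  | succ k ih =>
    have h := mul_digitVal hb (x := fun i => x (i + k)) fun i => hx _
    have h2 : (fun i => x (i + 1 + k)) = fun i => x (i + (k + 1)) := by
      funext i; congr 1; omega
    simp only [h2, zero_add] at h
    simp only [digitTrunc]
    push_cast
    rw [pow_succ, mul_comm _ (b : ℝ), mul_assoc, ih, mul_add, h]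
    ring

/-- Two numbers that share their first `k` digits differ by at most `b ^ (-k)`. -/
theorem abs_digitVal_sub_le {b : ℕ} (hb : 2 ≤ b) {x y : ℕ → ℕ} (hx : ∀ i, x i < b)
    (hy : ∀ i, y i < b) {k : ℕ} (h : ∀ i < k, x i = y i) :
    |digitVal b x - digitVal b y| ≤ 1 / (b : ℝ) ^ k := by
  have h1 := pow_mul_digitVal hb hx k
  have h2 := pow_mul_digitVal hb hy k
  rw [digitTrunc_congr k h] at h1
  have hk : (0 : ℝ) < (b : ℝ) ^ k := by positivity
  have b1 := digitVal_nonneg b fun i => x (i + k)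
  have b2 := digitVal_nonneg b fun i => y (i + k)
  have b3 := digitVal_le_one hb (x := fun i => x (i + k)) fun i => hx _
  have b4 := digitVal_le_one hb (x := fun i => y (i + k)) fun i => hy _
  rw [le_div_iff₀ hk, show |digitVal b x - digitVal b y| * (b : ℝ) ^ k =
    |(digitVal b x - digitVal b y) * (b : ℝ) ^ k| by rw [abs_mul, abs_of_pos hk], abs_le]
  constructor <;> nlinarith

/-- An interval of radius at most `b ^ (-k)` meets at most three values of the `k`-th prefix. -/
theorem exists_digitTrunc_near {b : ℕ} (hb : 2 ≤ b) {k : ℕ} {R : ℝ} (a : ℝ)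
    (hR : k = 0 ∨ (b : ℝ) ^ k * R ≤ 1) :
    ∃ c : ℤ, ∀ x : ℕ → ℕ, (∀ i, x i < b) → |digitVal b x - a| < R →
      (digitTrunc b x k : ℤ) - c ∈ Finset.Icc (-1 : ℤ) 1 := by
  rcases hR with rfl | hR
  · exact ⟨0, fun x _ _ => by simp [digitTrunc]⟩
  refine ⟨⌊(b : ℝ) ^ k * a⌋, fun x hx hxa => ?_⟩
  have hk : (0 : ℝ) < (b : ℝ) ^ k := by positivity
  have h1 := pow_mul_digitVal hb hx k
  have b1 := digitVal_nonneg b fun i => x (i + k)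
  have b3 := digitVal_le_one hb (x := fun i => x (i + k)) fun i => hx _
  have f1 := Int.floor_le ((b : ℝ) ^ k * a)
  have f2 := Int.lt_floor_add_one ((b : ℝ) ^ k * a)
  rw [abs_lt] at hxa
  have u1 : (b : ℝ) ^ k * digitVal b x - (b : ℝ) ^ k * a < 1 := by nlinarith
  have u2 : -1 < (b : ℝ) ^ k * digitVal b x - (b : ℝ) ^ k * a := by nlinarith
  have v1 : (digitTrunc b x k : ℤ) - ⌊(b : ℝ) ^ k * a⌋ < 2 := by
    have : ((digitTrunc b x k : ℝ)) - (⌊(b : ℝ) ^ k * a⌋ : ℝ) < 2 := by linarith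
    exact_mod_cast this
  have v2 : -2 < (digitTrunc b x k : ℤ) - ⌊(b : ℝ) ^ k * a⌋ := by
    have : (-2 : ℝ) < ((digitTrunc b x k : ℝ)) - (⌊(b : ℝ) ^ k * a⌋ : ℝ) := by linarith
    exact_mod_cast this
  rw [Finset.mem_Icc]
  omega

theorem abs_sub_le_dist_plane (w z : EuclideanSpace ℝ (Fin 2)) (i : Fin 2) :
    |w i - z i| ≤ dist w z := by
  rw [dist_eq_norm]
  simpa using PiLp.norm_apply_le (w - z) i

theorem dist_le_add_abs_plane (w z : EuclideanSpace ℝ (Fin 2)) :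
    dist w z ≤ |w 0 - z 0| + |w 1 - z 1| := by
  rw [EuclideanSpace.dist_eq, Fin.sum_univ_two, Real.dist_eq, Real.dist_eq]
  apply Real.sqrt_le_iff.mpr
  constructor
  · positivity
  · nlinarith [abs_nonneg (w 0 - z 0), abs_nonneg (w 1 - z 1)]

/-- A set that admits finitely many labels, with points of equal label at distance less than `r`,
is covered by at most as many `r`-balls. -/
theorem exists_cover_of_label {X β : Type*} [PseudoMetricSpace X] (E : Set X) (T : Finset β)
    (f : X → β) (r : ℝ) (hf : ∀ w ∈ E, f w ∈ T)
    (hd : ∀ w ∈ E, ∀ w' ∈ E, f w = f w' → dist w w' < r) :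
    ∃ F : Finset X, F.card ≤ T.card ∧ E ⊆ ⋃ y ∈ F, ball y r := by
  classical
  rcases E.eq_empty_or_nonempty with rfl | ⟨z, hz⟩
  · exact ⟨∅, by simp, by simp⟩
  have : ∀ c : β, ∃ y : X, (∃ w ∈ E, f w = c) → y ∈ E ∧ f y = c := by
    intro c
    by_cases h : ∃ w ∈ E, f w = c
    · obtain ⟨w, hw⟩ := h
      exact ⟨w, fun _ => hw⟩
    · exact ⟨z, fun h' => absurd h' h⟩
  choose g hg using this
  refine ⟨T.image g, Finset.card_image_le, fun w hw => ?_⟩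
  obtain ⟨h1, h2⟩ := hg (f w) ⟨w, hw, rfl⟩
  simp only [mem_iUnion, mem_ball]
  exact ⟨g (f w), Finset.mem_image_of_mem _ (hf w hw), hd w hw _ h1 h2.symm⟩

theorem exists_injOn_lt_card {α : Type*} (s : Finset α) :
    ∃ f : α → ℕ, InjOn f s ∧ ∀ a ∈ s, f a < s.card := by
  classical
  refine ⟨fun a => if h : a ∈ s then s.equivFin ⟨a, h⟩ else 0, fun a ha b hb hab => ?_,
    fun a ha => ?_⟩
  · have ha' : a ∈ s := ha
    have hb' : b ∈ s := hb
    simp only [ha', hb', dif_pos] at hab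
    simpa using s.equivFin.injective (Fin.ext hab)
  · simp [ha]

/-- The indices of the non-empty rows of `A`. -/
def rowIndices (m : ℕ) (A : Finset (ℕ × ℕ)) : Finset ℕ :=
  (Finset.range m).filter fun j => rowCount A j ≠ 0

theorem snd_mem_rowIndices {m : ℕ} {A : Finset (ℕ × ℕ)} {p : ℕ × ℕ} (hp : p ∈ A)
    (hpm : p.2 < m) : p.2 ∈ rowIndices m A := by
  simp only [rowIndices, Finset.mem_filter, Finset.mem_range]
  exact ⟨hpm, Finset.card_ne_zero.mpr ⟨p, by simp [hp]⟩⟩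

theorem rowCount_le_tVal {m : ℕ} (A : Finset (ℕ × ℕ)) {j : ℕ} (hj : j < m) :
    rowCount A j ≤ tVal m A :=
  Finset.le_sup (f := fun j => rowCount A j) (Finset.mem_range.mpr hj)

theorem sVal_pos {n m : ℕ} {A : Finset (ℕ × ℕ)} (hA : A.Nonempty)
    (hAsub : ∀ p ∈ A, p.1 < n ∧ p.2 < m) : 1 ≤ sVal m A := by
  obtain ⟨p, hp⟩ := hA
  exact Finset.card_pos.mpr ⟨_, snd_mem_rowIndices hp (hAsub p hp).2⟩

theorem tVal_pos {n m : ℕ} {A : Finset (ℕ × ℕ)} (hA : A.Nonempty)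
    (hAsub : ∀ p ∈ A, p.1 < n ∧ p.2 < m) : 1 ≤ tVal m A := by
  obtain ⟨p, hp⟩ := hA
  refine le_trans ?_ (rowCount_le_tVal A (hAsub p hp).2)
  exact Finset.card_pos.mpr ⟨p, by simp [hp]⟩

theorem exists_rowCount_eq_tVal {m : ℕ} (hm : 0 < m) (A : Finset (ℕ × ℕ)) :
    ∃ j < m, rowCount A j = tVal m A := by
  obtain ⟨j, hj, h⟩ := Finset.exists_mem_eq_sup (Finset.range m)
    (Finset.nonempty_range_iff.mpr hm.ne') fun j => rowCount A j
  exact ⟨j, Finset.mem_range.mp hj, h.symm⟩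

/-- Points of the carpet whose codes start with prescribed words, up to a bounded ambiguity,
are covered by the number of continuations of these words. -/
theorem exists_cover_card_le {n m : ℕ} (hm : 2 ≤ m) (hn : 2 ≤ n) {A : Finset (ℕ × ℕ)}
    (hAsub : ∀ p ∈ A, p.1 < n ∧ p.2 < m) (z : EuclideanSpace ℝ (Fin 2)) {r R : ℝ}
    {k l k' l' : ℕ} (hk : k = 0 ∨ (n : ℝ) ^ k * R ≤ 1) (hl : l = 0 ∨ (m : ℝ) ^ l * R ≤ 1)
    (hkl : k' ≤ l') (hk' : 1 / (n : ℝ) ^ k' < r / 2) (hl' : 1 / (m : ℝ) ^ l' < r / 2) :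
    ∃ F : Finset (EuclideanSpace ℝ (Fin 2)),
      F.card ≤ 9 * (sVal m A ^ (l' - l) * tVal m A ^ (k' - k)) ∧
      bmCarpet n m A ∩ ball z R ⊆ ⋃ y ∈ F, ball y r := by
  classical
  obtain ⟨c, hc⟩ := exists_digitTrunc_near hn (z 0) hk
  obtain ⟨d, hd⟩ := exists_digitTrunc_near hm (z 1) hl
  choose e he_inj he_lt using fun j => exists_injOn_lt_card (A.filter fun p => p.2 = j)
  have hcode : ∀ w : EuclideanSpace ℝ (Fin 2), ∃ x y : ℕ → ℕ, w ∈ bmCarpet n m A →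
      (∀ i, (x i, y i) ∈ A) ∧ w 0 = digitVal n x ∧ w 1 = digitVal m y := by
    intro w
    by_cases h : w ∈ bmCarpet n m A
    · obtain ⟨x, y, h⟩ := h
      exact ⟨x, y, fun _ => h⟩
    · exact ⟨0, 0, fun h' => absurd h' h⟩
  choose x y hxy using hcode
  let T : Finset ((ℤ × ℤ) × ((Fin (l' - l) → ℕ) × (Fin (k' - k) → ℕ))) :=
    (Finset.Icc (-1) 1 ×ˢ Finset.Icc (-1) 1) ×ˢ
      (Fintype.piFinset (fun _ => rowIndices m A) ×ˢ
        Fintype.piFinset (fun _ => Finset.range (tVal m A)))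
  have hT : T.card = 9 * (sVal m A ^ (l' - l) * tVal m A ^ (k' - k)) := by
    simp [T, sVal, rowIndices]
  rw [← hT]
  refine exists_cover_of_label _ T (fun w =>
    ((digitTrunc n (x w) k - c, digitTrunc m (y w) l - d),
      (fun i => y w (l + i), fun i => e (y w (k + i)) (x w (k + i), y w (k + i))))) r ?_ ?_
  · rintro w ⟨hw, hwz⟩
    obtain ⟨hwA, hw0, hw1⟩ := hxy w hw
    have h0 := (abs_sub_le_dist_plane w z 0).trans_lt hwz
    have h1 := (abs_sub_le_dist_plane w z 1).trans_lt hwz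
    rw [hw0] at h0
    rw [hw1] at h1
    simp only [T, Finset.mem_product, Fintype.mem_piFinset, Finset.mem_range]
    refine ⟨⟨hc _ (fun i => (hAsub _ (hwA i)).1) h0, hd _ (fun i => (hAsub _ (hwA i)).2) h1⟩,
      fun i => snd_mem_rowIndices (hwA _) (hAsub _ (hwA _)).2, fun i => ?_⟩
    exact (he_lt _ _ (by simp [hwA])).trans_le (rowCount_le_tVal A (hAsub _ (hwA _)).2)
  · rintro w ⟨hw, -⟩ w' ⟨hw', -⟩ heq
    obtain ⟨hwA, hw0, hw1⟩ := hxy w hw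
    obtain ⟨hwA', hw0', hw1'⟩ := hxy w' hw'
    simp only [Prod.mk.injEq, sub_left_inj, Nat.cast_inj] at heq
    obtain ⟨⟨hp, hq⟩, hv, hu⟩ := heq
    have hX := fun i => (hAsub _ (hwA i)).1
    have hX' := fun i => (hAsub _ (hwA' i)).1
    have hY := fun i => (hAsub _ (hwA i)).2
    have hY' := fun i => (hAsub _ (hwA' i)).2
    have hy : ∀ i < l', y w i = y w' i := by
      intro i hi
      by_cases hil : i < l
      · exact eq_of_digitTrunc_eq hY hY' l hq i hil
      · have := congrFun hv ⟨i - l, by omega⟩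
        simpa [Nat.add_sub_cancel' (not_lt.mp hil)] using this
    have hx : ∀ i < k', x w i = x w' i := by
      intro i hi
      by_cases hik : i < k
      · exact eq_of_digitTrunc_eq hX hX' k hp i hik
      · have h := congrFun hu ⟨i - k, by omega⟩
        simp only [Nat.add_sub_cancel' (not_lt.mp hik), ← hy i (by omega)] at h
        have := he_inj (y w i) (by simp [hwA])
          (by simpa [hy i (by omega)] using hwA' i) h
        exact (Prod.mk.inj this).1
    have h0 := abs_digitVal_sub_le hn hX hX' hx
    have h1 := abs_digitVal_sub_le hm hY hY' hy
    rw [← hw0, ← hw0'] at h0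
    rw [← hw1, ← hw1'] at h1
    linarith [dist_le_add_abs_plane w w']

/-- The coarsest level of the `b`-adic scale finer than `ρ`. -/
theorem exists_level {b : ℕ} (hb : 2 ≤ b) {ρ : ℝ} (hρ : 0 < ρ) :
    ∃ k : ℕ, 1 / (b : ℝ) ^ k < ρ ∧ ∀ j < k, (b : ℝ) ^ j * ρ ≤ 1 := by
  classical
  have hb' : (1 : ℝ) < b := by exact_mod_cast (by omega : 1 < b)
  have hex : ∃ k : ℕ, 1 / (b : ℝ) ^ k < ρ := by
    obtain ⟨k, hk⟩ := pow_unbounded_of_one_lt (1 / ρ) hb'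
    refine ⟨k, ?_⟩
    rw [div_lt_iff₀ (by positivity)] at hk ⊢
    linarith
  refine ⟨Nat.find hex, Nat.find_spec hex, fun j hj => ?_⟩
  have := Nat.find_min hex hj
  rw [not_lt, le_div_iff₀ (by positivity)] at this
  linarith

theorem pow_eq_rpow_logb {b c : ℕ} (hb : 2 ≤ b) (hc : 1 ≤ c) (a : ℕ) :
    (c : ℝ) ^ a = ((b : ℝ) ^ a) ^ Real.logb b c := by
  have hb' : (1 : ℝ) < b := by exact_mod_cast (by omega : 1 < b)
  have hc' : (0 : ℝ) < c := by exact_mod_cast hc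
  rw [← Real.rpow_natCast (b : ℝ) a, ← Real.rpow_mul (by positivity), mul_comm,
    Real.rpow_mul (by positivity), Real.rpow_logb (by linarith) hb'.ne' hc', Real.rpow_natCast]

theorem logb_natCast_nonneg {b c : ℕ} (hb : 2 ≤ b) (hc : 1 ≤ c) : 0 ≤ Real.logb b c :=
  Real.logb_nonneg (by exact_mod_cast (by omega : 1 < b)) (by exact_mod_cast hc)

/-- Adjacent levels for `R` and `r / 2` are `log_b (R / r) + O(1)` apart. -/
theorem pow_level_sub_le {b : ℕ} (hb : 2 ≤ b) {r R : ℝ} (hr : 0 < r) (hrR : r ≤ R) {κ k' : ℕ}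
    (hκ : 1 / (b : ℝ) ^ κ < R) (hk' : ∀ j < k', (b : ℝ) ^ j * (r / 2) ≤ 1) :
    (b : ℝ) ^ (k' - (κ - 1)) ≤ 2 * (b : ℝ) ^ 2 * (R / r) := by
  have hb' : (1 : ℝ) < b := by exact_mod_cast (by omega : 1 < b)
  have hRr : 1 ≤ R / r := (one_le_div hr).mpr hrR
  rcases le_or_gt k' (κ - 1) with h | h
  · rw [Nat.sub_eq_zero_of_le h, pow_zero]
    nlinarith
  have h1 := hk' (k' - 1) (by omega)
  rw [div_lt_iff₀ (by positivity)] at hκ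
  have h2 : (b : ℝ) ^ κ ≤ b * (b : ℝ) ^ (κ - 1) := by
    rw [← pow_succ']
    exact pow_le_pow_right₀ hb'.le (by omega)
  have h3 : (b : ℝ) ^ k' = b * (b : ℝ) ^ (k' - 1) := by
    rw [← pow_succ']
    congr 1
    omega
  have h4 : (b : ℝ) ^ (k' - (κ - 1)) * (b : ℝ) ^ (κ - 1) = (b : ℝ) ^ k' := by
    rw [← pow_add]
    congr 1
    omega
  have hR : 0 < R := hr.trans_le hrR
  have hP : (0 : ℝ) < (b : ℝ) ^ (κ - 1) := by positivity
  rw [← mul_div_assoc, le_div_iff₀ hr]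
  refine le_of_mul_le_mul_right ?_ hP
  calc (b : ℝ) ^ (k' - (κ - 1)) * r * (b : ℝ) ^ (κ - 1)
      = 2 * b * ((b : ℝ) ^ (k' - 1) * (r / 2)) := by
        rw [mul_right_comm, h4, h3]; ring
    _ ≤ 2 * b * (R * (b : ℝ) ^ κ) :=
        mul_le_mul_of_nonneg_left (h1.trans hκ.le) (by positivity)
    _ ≤ 2 * b * (R * (b * (b : ℝ) ^ (κ - 1))) := by gcongr
    _ = 2 * (b : ℝ) ^ 2 * R * (b : ℝ) ^ (κ - 1) := by ring

theorem bmCarpet_covering_bound {n m : ℕ} (hm : 2 ≤ m) (hmn : m < n) {A : Finset (ℕ × ℕ)}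
    (hA : A.Nonempty) (hAsub : ∀ p ∈ A, p.1 < n ∧ p.2 < m) :
    ∃ C : ℝ, 0 < C ∧ ∀ x ∈ bmCarpet n m A, ∀ r R : ℝ, 0 < r → r ≤ R →
      ∃ F : Finset (EuclideanSpace ℝ (Fin 2)),
        (F.card : ℝ) ≤ C * (R / r) ^ (Real.logb m (sVal m A) + Real.logb n (tVal m A)) ∧
        bmCarpet n m A ∩ ball x R ⊆ ⋃ y ∈ F, ball y r := by
  have hn : 2 ≤ n := by omega
  have hs := sVal_pos hA hAsub
  have ht := tVal_pos hA hAsub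
  refine ⟨9 * ((2 * (m : ℝ) ^ 2) ^ Real.logb m (sVal m A) *
    (2 * (n : ℝ) ^ 2) ^ Real.logb n (tVal m A)), by positivity, fun z _ r R hr hrR => ?_⟩
  have hR : 0 < R := hr.trans_le hrR
  obtain ⟨κ, hκ, hκ'⟩ := exists_level hn hR
  obtain ⟨μ, hμ, hμ'⟩ := exists_level hm hR
  obtain ⟨k', hk, hk'⟩ := exists_level hn (half_pos hr)
  obtain ⟨l', hl, hl'⟩ := exists_level hm (half_pos hr)
  have hkl : k' ≤ l' := by
    by_contra! h
    have h1 := hk' l' h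
    rw [div_lt_iff₀ (by positivity)] at hl
    have h2 : (m : ℝ) ^ l' ≤ (n : ℝ) ^ l' := by gcongr
    nlinarith
  obtain ⟨F, hF, hcov⟩ := exists_cover_card_le hm hn hAsub z (k := κ - 1) (l := μ - 1)
    (or_iff_not_imp_left.mpr fun h => hκ' _ (by omega))
    (or_iff_not_imp_left.mpr fun h => hμ' _ (by omega)) hkl hk hl
  refine ⟨F, ?_, hcov⟩
  have hF' : (F.card : ℝ) ≤ 9 * ((sVal m A : ℝ) ^ (l' - (μ - 1)) *
      (tVal m A : ℝ) ^ (k' - (κ - 1))) := by exact_mod_cast hF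
  refine hF'.trans ?_
  have hRr : 0 < R / r := by positivity
  rw [pow_eq_rpow_logb hm hs, pow_eq_rpow_logb hn ht, Real.rpow_add hRr]
  have h1 := Real.rpow_le_rpow (by positivity) (pow_level_sub_le hm hr hrR hμ hl')
    (logb_natCast_nonneg hm hs)
  have h2 := Real.rpow_le_rpow (by positivity) (pow_level_sub_le hn hr hrR hκ hk')
    (logb_natCast_nonneg hn ht)
  rw [Real.mul_rpow (by positivity) hRr.le] at h1 h2
  calc _ ≤ 9 * (((2 * (m : ℝ) ^ 2) ^ Real.logb m (sVal m A) *
        (R / r) ^ Real.logb m (sVal m A)) * ((2 * (n : ℝ) ^ 2) ^ Real.logb n (tVal m A) *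
        (R / r) ^ Real.logb n (tVal m A))) := by gcongr
    _ = _ := by ring

/-- The sequence equal to `c` except for the block `u` inserted at position `k`. -/
def insertBlock {α : Type*} (k : ℕ) {p : ℕ} (u : Fin p → α) (c : α) (i : ℕ) : α :=
  if h : k ≤ i ∧ i < k + p then u ⟨i - k, by omega⟩ else c

theorem insertBlock_of_lt {α : Type*} {k p : ℕ} (u : Fin p → α) (c : α) {i : ℕ} (h : i < k) :
    insertBlock k u c i = c :=
  dif_neg (by omega)

theorem insertBlock_add {α : Type*} {k p : ℕ} (u : Fin p → α) (c : α) (i : Fin p) :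
    insertBlock k u c (k + i) = u i := by
  have := i.isLt
  simp [insertBlock]

theorem insertBlock_mem {α : Type*} {k p : ℕ} {u : Fin p → α} {c : α} {P : α → Prop}
    (hu : ∀ i, P (u i)) (hc : P c) (i : ℕ) : P (insertBlock k u c i) := by
  unfold insertBlock
  split
  · exact hu _
  · exact hc

/-- Any cover of the part of the carpet in a suitable ball of radius `3 n ^ (-k)` by balls of radius
`n ^ (-(k + p)) / m` has at least `t ^ p * s ^ q / 9` members, where `q ≈ p * log_m n`. -/
theorem card_cover_ge {n m : ℕ} (hm : 2 ≤ m) (hmn : m < n) {A : Finset (ℕ × ℕ)}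
    (hA : A.Nonempty) (hAsub : ∀ p ∈ A, p.1 < n ∧ p.2 < m) {k l p q : ℕ}
    (hkl : k + p ≤ l) (hl : n ^ k ≤ m ^ l) (hq : m ^ (l + q) ≤ m * n ^ (k + p)) :
    ∃ z ∈ bmCarpet n m A, ∀ F : Finset (EuclideanSpace ℝ (Fin 2)),
      bmCarpet n m A ∩ ball z (3 / (n : ℝ) ^ k) ⊆ ⋃ y ∈ F, ball y (1 / (m * (n : ℝ) ^ (k + p))) →
      tVal m A ^ p * sVal m A ^ q ≤ 9 * F.card := by
  classical
  have hn : 2 ≤ n := by omega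
  obtain ⟨j, hj, hjt⟩ := exists_rowCount_eq_tVal (by omega : 0 < m) A
  have htpos := tVal_pos hA hAsub
  obtain ⟨⟨i₀, j'⟩, hij⟩ : (A.filter fun p => p.2 = j).Nonempty := by
    rw [← Finset.card_pos]
    change 0 < rowCount A j
    omega
  obtain ⟨hp₀, rfl⟩ : (i₀, j') ∈ A ∧ j' = j := by simpa using hij
  have hg : ∀ a, ∃ b, a ∈ rowIndices m A → (b, a) ∈ A := by
    intro a
    by_cases h : a ∈ rowIndices m A
    · obtain ⟨⟨b, a'⟩, hba⟩ := Finset.card_ne_zero.mp (Finset.mem_filter.mp h).2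
      obtain ⟨hb, rfl⟩ : (b, a') ∈ A ∧ a' = a := by simpa using hba
      exact ⟨b, fun _ => hb⟩
    · exact ⟨0, fun h' => absurd h' h⟩
  choose g hg using hg
  let T : Finset ((Fin p → ℕ × ℕ) × (Fin q → ℕ)) :=
    Fintype.piFinset (fun _ => A.filter fun a => a.2 = j') ×ˢ
      Fintype.piFinset (fun _ => rowIndices m A)
  have hT : T.card = tVal m A ^ p * sVal m A ^ q := by
    simp [T, ← hjt, rowCount, sVal, rowIndices]
  let code : (Fin p → ℕ × ℕ) × (Fin q → ℕ) → ℕ → ℕ × ℕ := fun a i =>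
    if i < l then insertBlock k a.1 (i₀, j') i
    else insertBlock l (fun b => (g (a.2 b), a.2 b)) (i₀, j') i
  let pt : (Fin p → ℕ × ℕ) × (Fin q → ℕ) → EuclideanSpace ℝ (Fin 2) := fun a =>
    !₂[digitVal n fun i => (code a i).1, digitVal m fun i => (code a i).2]
  have hcode : ∀ a ∈ T, ∀ i, code a i ∈ A := by
    intro a ha i
    simp only [T, Finset.mem_product, Fintype.mem_piFinset, Finset.mem_filter] at ha
    simp only [code]
    split
    · exact insertBlock_mem (fun i => (ha.1 i).1) hp₀ i
    · exact insertBlock_mem (P := (· ∈ A)) (fun i => hg _ (ha.2 i)) hp₀ i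
  have hpt : ∀ a ∈ T, pt a ∈ bmCarpet n m A := fun a ha =>
    ⟨fun i => (code a i).1, fun i => (code a i).2, hcode a ha, rfl, rfl⟩
  have hx : ∀ a ∈ T, ∀ i, (code a i).1 < n := fun a ha i => (hAsub _ (hcode a ha i)).1
  have hy : ∀ a ∈ T, ∀ i, (code a i).2 < m := fun a ha i => (hAsub _ (hcode a ha i)).2
  have hcode_lt : ∀ a, ∀ i < k, code a i = (i₀, j') := fun a i hi => by
    simp only [code, if_pos (by omega : i < l)]
    exact insertBlock_of_lt _ _ hi
  have hcode_row : ∀ a ∈ T, ∀ i < l, (code a i).2 = j' := by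
    intro a ha i hi
    simp only [T, Finset.mem_product, Fintype.mem_piFinset, Finset.mem_filter] at ha
    simp only [code, if_pos hi]
    exact insertBlock_mem (P := fun b : ℕ × ℕ => b.2 = j') (fun i => (ha.1 i).2) rfl i
  obtain ⟨a₀, ha₀⟩ : T.Nonempty := by
    rw [← Finset.card_pos, hT]
    have := sVal_pos hA hAsub
    positivity
  have hclose : ∀ a ∈ T, pt a ∈ ball (pt a₀) (3 / (n : ℝ) ^ k) := by
    intro a ha
    have h0 := abs_digitVal_sub_le hn (hx a ha) (hx a₀ ha₀) (k := k)
      fun i hi => by rw [hcode_lt a i hi, hcode_lt a₀ i hi]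
    have h1 := abs_digitVal_sub_le hm (hy a ha) (hy a₀ ha₀) (k := l)
      fun i hi => by rw [hcode_row a ha i hi, hcode_row a₀ ha₀ i hi]
    have h2 : 1 / (m : ℝ) ^ l ≤ 1 / (n : ℝ) ^ k := by
      have : (n : ℝ) ^ k ≤ (m : ℝ) ^ l := by exact_mod_cast hl
      gcongr
    have h3 : (0 : ℝ) < 1 / (n : ℝ) ^ k := by positivity
    have h4 : 3 / (n : ℝ) ^ k = 3 * (1 / (n : ℝ) ^ k) := by ring
    have h5 := dist_le_add_abs_plane (pt a) (pt a₀)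
    have e0 : ∀ a, (pt a) 0 = digitVal n fun i => (code a i).1 := fun _ => rfl
    have e1 : ∀ a, (pt a) 1 = digitVal m fun i => (code a i).2 := fun _ => rfl
    rw [e0, e0, e1, e1] at h5
    rw [mem_ball, h4]
    linarith
  refine ⟨pt a₀, hpt a₀ ha₀, fun F hF => ?_⟩
  have hmaps : ∀ a, ∃ y, a ∈ T → y ∈ F ∧ pt a ∈ ball y (1 / (m * (n : ℝ) ^ (k + p))) := by
    intro a
    by_cases ha : a ∈ T
    · have := hF ⟨hpt a ha, hclose a ha⟩
      simp only [mem_iUnion] at this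
      obtain ⟨y, hy, h⟩ := this
      exact ⟨y, fun _ => ⟨hy, h⟩⟩
    · exact ⟨0, fun h => absurd h ha⟩
  choose f hf using hmaps
  rw [← hT]
  refine Finset.card_le_mul_card_image_of_maps_to (f := f) (fun a ha => (hf a ha).1) 9
    fun y _ => ?_
  obtain ⟨c, hc⟩ := exists_digitTrunc_near hn (y 0) (k := k + p)
    (R := 1 / (m * (n : ℝ) ^ (k + p))) (Or.inr (by
      have : (1 : ℝ) ≤ m := by exact_mod_cast (by omega : 1 ≤ m)
      field_simp
      exact this))
  obtain ⟨d, hd⟩ := exists_digitTrunc_near hm (y 1) (k := l + q)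
    (R := 1 / (m * (n : ℝ) ^ (k + p))) (Or.inr (by
      have : (m : ℝ) ^ (l + q) ≤ m * (n : ℝ) ^ (k + p) := by exact_mod_cast hq
      rw [mul_one_div]
      exact div_le_one_of_le₀ this (by positivity)))
  have hcard : ((Finset.Icc (-1 : ℤ) 1) ×ˢ (Finset.Icc (-1 : ℤ) 1)).card = 9 := by simp
  rw [← hcard]
  refine Finset.card_le_card_of_injOn
    (fun a => ((digitTrunc n (fun i => (code a i).1) (k + p) : ℤ) - c,
      (digitTrunc m (fun i => (code a i).2) (l + q) : ℤ) - d)) ?_ ?_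
  · intro a ha
    obtain ⟨haT, rfl⟩ := Finset.mem_filter.mp ha
    have h := (hf a haT).2
    exact Finset.mem_coe.mpr (Finset.mem_product.mpr
      ⟨hc _ (hx a haT) ((abs_sub_le_dist_plane (pt a) (f a) 0).trans_lt h),
        hd _ (hy a haT) ((abs_sub_le_dist_plane (pt a) (f a) 1).trans_lt h)⟩)
  · intro a ha b hb hab
    have ha := (Finset.mem_filter.mp ha).1
    have hb := (Finset.mem_filter.mp hb).1
    simp only [Prod.mk.injEq, sub_left_inj, Nat.cast_inj] at hab
    have h0 := eq_of_digitTrunc_eq (hx a ha) (hx b hb) _ hab.1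
    have h1 := eq_of_digitTrunc_eq (hy a ha) (hy b hb) _ hab.2
    refine Prod.ext (funext fun i => ?_) (funext fun i => ?_)
    · have hi := i.isLt
      have e : ∀ a, code a (k + i) = a.1 i := fun a => by
        simp only [code, if_pos (by omega : k + (i : ℕ) < l)]
        exact insertBlock_add _ _ i
      rw [← e a, ← e b]
      refine Prod.ext (h0 _ (by omega)) ?_
      rw [hcode_row a ha _ (by omega), hcode_row b hb _ (by omega)]
    · have hi := i.isLt
      have e : ∀ a, (code a (l + i)).2 = a.2 i := fun a => by
        simp only [code, if_neg (by omega : ¬ l + (i : ℕ) < l)]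
        rw [insertBlock_add]
      rw [← e a, ← e b]
      exact h1 _ (by omega)

theorem exists_pow_add_le_pow {n m : ℕ} (hm : 2 ≤ m) (hmn : m < n) (p : ℕ) :
    ∃ k, m ^ (k + p) ≤ n ^ k := by
  have hm' : (0 : ℝ) < m := by positivity
  have h1 : (1 : ℝ) < n / m := by
    rw [one_lt_div hm']
    exact_mod_cast hmn
  obtain ⟨k, hk⟩ := pow_unbounded_of_one_lt ((m : ℝ) ^ p) h1
  refine ⟨k, ?_⟩
  rw [div_pow, lt_div_iff₀ (by positivity)] at hk
  have : (m : ℝ) ^ (k + p) ≤ (n : ℝ) ^ k := by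
    rw [pow_add]
    linarith
  exact_mod_cast this

theorem le_of_bmCarpet_covering_bound {n m : ℕ} (hm : 2 ≤ m) (hmn : m < n) {A : Finset (ℕ × ℕ)}
    (hA : A.Nonempty) (hAsub : ∀ p ∈ A, p.1 < n ∧ p.2 < m) {α C : ℝ}
    (h : ∀ x ∈ bmCarpet n m A, ∀ r R : ℝ, 0 < r → r ≤ R →
      ∃ F : Finset (EuclideanSpace ℝ (Fin 2)), (F.card : ℝ) ≤ C * (R / r) ^ α ∧
        bmCarpet n m A ∩ ball x R ⊆ ⋃ y ∈ F, ball y r) :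
    Real.logb m (sVal m A) + Real.logb n (tVal m A) ≤ α := by
  have hn : 2 ≤ n := by omega
  have hs := sVal_pos hA hAsub
  have ht := tVal_pos hA hAsub
  have hm0 : (0 : ℝ) < m := by positivity
  have hm1 : (1 : ℝ) ≤ m := by exact_mod_cast (by omega : 1 ≤ m)
  have hn1 : (1 : ℝ) < n := by exact_mod_cast (by omega : 1 < n)
  set D₁ := Real.logb m (sVal m A) with hD₁
  set D₂ := Real.logb n (tVal m A) with hD₂
  have key : ∀ p : ℕ, ((n : ℝ) ^ p) ^ (D₁ + D₂) ≤
      (m : ℝ) ^ D₁ * (9 * C * (3 * m) ^ α) * ((n : ℝ) ^ p) ^ α := by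
    intro p
    obtain ⟨k, hk⟩ := exists_pow_add_le_pow hm hmn p
    have hm1' : 1 < m := by omega
    have hnk : n ^ k ≠ 0 := by positivity
    have hl : n ^ k ≤ m ^ Nat.clog m (n ^ k) := Nat.le_pow_clog hm1' _
    have hkl : k + p ≤ Nat.clog m (n ^ k) :=
      (Nat.pow_le_pow_iff_right hm1').mp (hk.trans hl)
    have hl' : m ^ Nat.clog m (n ^ k) ≤ m * n ^ k := by
      rcases Nat.eq_zero_or_pos (Nat.clog m (n ^ k)) with h0 | h0
      · rw [h0, pow_zero]
        exact Nat.mul_pos (by omega) (by positivity)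
      · have : m ^ (Nat.clog m (n ^ k) - 1) < n ^ k :=
          (Nat.lt_clog_iff_pow_lt hm1').mp (by omega)
        calc m ^ Nat.clog m (n ^ k) = m * m ^ (Nat.clog m (n ^ k) - 1) := by
              rw [← pow_succ']; congr 1; omega
          _ ≤ m * n ^ k := Nat.mul_le_mul_left _ this.le
    set l := Nat.clog m (n ^ k)
    set q := Nat.log m (n ^ p)
    have hq : m ^ q ≤ n ^ p := Nat.pow_log_le_self m (by positivity)
    have hq' : n ^ p < m ^ (q + 1) := Nat.lt_pow_succ_log_self hm1' _
    have hlq : m ^ (l + q) ≤ m * n ^ (k + p) := by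
      rw [pow_add, pow_add, ← mul_assoc]
      exact Nat.mul_le_mul hl' hq
    obtain ⟨z, hz, hcount⟩ := card_cover_ge hm hmn hA hAsub hkl hl hlq
    have hle : 1 / (m * (n : ℝ) ^ (k + p)) ≤ 3 / (n : ℝ) ^ k := by
      have h1 : (n : ℝ) ^ k ≤ (n : ℝ) ^ (k + p) := pow_le_pow_right₀ hn1.le (by omega)
      have h2 : (0 : ℝ) < (n : ℝ) ^ k := by positivity
      gcongr
      · norm_num
      · nlinarith
    obtain ⟨F, hF, hcov⟩ := h z hz _ _ (by positivity) hle
    have hc : (tVal m A : ℝ) ^ p * (sVal m A : ℝ) ^ q ≤ 9 * F.card := by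
      exact_mod_cast hcount F hcov
    have hratio : 3 / (n : ℝ) ^ k / (1 / (m * (n : ℝ) ^ (k + p))) = 3 * m * (n : ℝ) ^ p := by
      rw [pow_add]
      field_simp
    rw [hratio, Real.mul_rpow (by positivity) (by positivity)] at hF
    rw [pow_eq_rpow_logb hn ht, pow_eq_rpow_logb hm hs, ← hD₁, ← hD₂] at hc
    have hq'' : (n : ℝ) ^ p ≤ m * (m : ℝ) ^ q := by
      rw [← pow_succ']
      exact_mod_cast hq'.le
    have h3 := Real.rpow_le_rpow (by positivity) hq'' (logb_natCast_nonneg hm hs)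
    rw [← hD₁, Real.mul_rpow (by positivity) (by positivity)] at h3
    rw [Real.rpow_add (by positivity)]
    calc ((n : ℝ) ^ p) ^ D₁ * ((n : ℝ) ^ p) ^ D₂
        ≤ ((m : ℝ) ^ D₁ * ((m : ℝ) ^ q) ^ D₁) * ((n : ℝ) ^ p) ^ D₂ := by gcongr
      _ = (m : ℝ) ^ D₁ * (((n : ℝ) ^ p) ^ D₂ * ((m : ℝ) ^ q) ^ D₁) := by ring
      _ ≤ (m : ℝ) ^ D₁ * (9 * (C * ((3 * m) ^ α * ((n : ℝ) ^ p) ^ α))) := by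
        refine mul_le_mul_of_nonneg_left (hc.trans ?_) (by positivity)
        gcongr
      _ = _ := by ring
  by_contra! hlt
  have hgt : 1 < (n : ℝ) ^ (D₁ + D₂ - α) := Real.one_lt_rpow hn1 (by linarith)
  obtain ⟨p, hp⟩ := pow_unbounded_of_one_lt ((m : ℝ) ^ D₁ * (9 * C * (3 * m) ^ α)) hgt
  have hkey := key p
  have hpos : (0 : ℝ) < ((n : ℝ) ^ p) ^ α := by positivity
  rw [← div_le_iff₀ hpos, ← Real.rpow_sub (by positivity), ← Real.rpow_natCast (n : ℝ) p,
    ← Real.rpow_mul (by positivity), mul_comm, Real.rpow_mul (by positivity),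
    Real.rpow_natCast] at hkey
  linarith

/-- For `n > m ≥ 2` and non-empty `A ⊆ {0,…,n−1} × {0,…,m−1}`, the
Assouad dimension of the Bedford–McMullen carpet `S(A)` equals `log_m s + log_n t`. -/
theorem bm_assouadDim_eq (n m : ℕ) (hm : 2 ≤ m) (hmn : m < n)
    (A : Finset (ℕ × ℕ)) (hA : A.Nonempty)
    (hAsub : ∀ p ∈ A, p.1 < n ∧ p.2 < m) :
    assouadDim (bmCarpet n m A) =
      Real.logb m (sVal m A) + Real.logb n (tVal m A) := by
  have hn : 2 ≤ n := by omega
  have hmem := bmCarpet_covering_bound hm hmn hA hAsub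
  apply le_antisymm
  · exact csInf_le ⟨0, fun α hα => hα.1⟩
      ⟨add_nonneg (logb_natCast_nonneg hm (sVal_pos hA hAsub))
        (logb_natCast_nonneg hn (tVal_pos hA hAsub)), hmem⟩
  · refine le_csInf ⟨_, add_nonneg (logb_natCast_nonneg hm (sVal_pos hA hAsub))
      (logb_natCast_nonneg hn (tVal_pos hA hAsub)), hmem⟩ ?_
    rintro α ⟨-, C, -, h⟩
    exact le_of_bmCarpet_covering_bound hm hmn hA hAsub h
end

section
/- Let n > m ≥ 2 be integers and A ⊆ {0,1,…,n−1} × {0,1,…,m−1} a non-empty set. Then the Assouad dimension of the Bedford–McMullen carpet S(A) is at least log_m(s) + log_n(t). -/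
open Set Metric Filter

/-- The real number in `[0, 1]` whose base-`b` expansion has digits `a 0, a 1, …`. -/
noncomputable def expansion (b : ℕ) (a : ℕ → ℕ) : ℝ := ∑' i : ℕ, (a i : ℝ) / (b : ℝ) ^ (i + 1)

section Expansion

variable {b : ℕ}

lemma expansion_summable (hb : 2 ≤ b) {a : ℕ → ℕ} (ha : ∀ i, a i < b) :
    Summable fun i : ℕ => (a i : ℝ) / (b : ℝ) ^ (i + 1) := by
  have hb' : (2 : ℝ) ≤ b := by exact_mod_cast hb
  refine Summable.of_nonneg_of_le (fun i => by positivity) (fun i => ?_)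
    (summable_geometric_of_lt_one (r := ((b : ℝ)⁻¹)) (by positivity)
      (inv_lt_one_of_one_lt₀ (by linarith)))
  have : (a i : ℝ) ≤ b := by exact_mod_cast (ha i).le
  rw [inv_pow, div_le_iff₀ (by positivity), pow_succ, inv_mul_cancel_left₀ (by positivity)]
  exact this

lemma expansion_eq_shift (hb : 2 ≤ b) {a : ℕ → ℕ} (ha : ∀ i, a i < b) :
    expansion b a = (a 0 + expansion b fun i => a (i + 1)) / b := by
  rw [expansion, (expansion_summable hb ha).tsum_eq_zero_add, expansion, add_div, ← tsum_div_const]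
  congr 1
  · simp
  · refine tsum_congr fun i => ?_
    rw [pow_succ, div_mul_eq_div_div]

lemma expansion_nonneg (a : ℕ → ℕ) : 0 ≤ expansion b a :=
  tsum_nonneg fun _ => by positivity

lemma expansion_le_one (hb : 2 ≤ b) {a : ℕ → ℕ} (ha : ∀ i, a i < b) : expansion b a ≤ 1 := by
  have hb' : (2 : ℝ) ≤ b := by exact_mod_cast hb
  have hs : HasSum (fun i : ℕ => ((b : ℝ) - 1) / (b : ℝ) ^ (i + 1)) 1 := by
    have h := (hasSum_geometric_of_lt_one (r := ((b : ℝ)⁻¹)) (by positivity)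
      (inv_lt_one_of_one_lt₀ (by linarith))).mul_left (((b : ℝ) - 1) / b)
    have hb1 : (b : ℝ) - 1 ≠ 0 := by linarith
    have h1 : ((b : ℝ) - 1) / b * (1 - (b : ℝ)⁻¹)⁻¹ = 1 := by field_simp
    rw [h1] at h
    refine (congrArg (HasSum · (1 : ℝ)) (funext fun i => ?_)).mpr h
    rw [pow_succ, inv_pow]
    field_simp
  rw [← hs.tsum_eq]
  refine (expansion_summable hb ha).tsum_le_tsum (fun i => ?_) hs.summable
  have : (a i : ℝ) + 1 ≤ b := by exact_mod_cast ha i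
  gcongr
  linarith

lemma abs_expansion_sub_le_of_agree_before (hb : 2 ≤ b) (N : ℕ) {a c : ℕ → ℕ}
    (ha : ∀ i, a i < b) (hc : ∀ i, c i < b) (h : ∀ i < N, a i = c i) :
    |expansion b a - expansion b c| ≤ 1 / (b : ℝ) ^ N := by
  have hb' : (0 : ℝ) < b := by exact_mod_cast (by omega : 0 < b)
  induction N generalizing a c with
  | zero =>
    have h1 := expansion_nonneg (b := b) a
    have h2 := expansion_nonneg (b := b) c
    have h3 := expansion_le_one hb ha
    have h4 := expansion_le_one hb hc
    rw [pow_zero, div_one, abs_le]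
    constructor <;> linarith
  | succ N ih =>
    have := ih (a := fun i => a (i + 1)) (c := fun i => c (i + 1)) (fun i => ha _)
      (fun i => hc _) (fun i hi => h _ (by omega))
    rw [expansion_eq_shift hb ha, expansion_eq_shift hb hc, h 0 (by omega), ← sub_div,
      add_sub_add_left_eq_sub, abs_div, abs_of_pos hb', pow_succ, div_mul_eq_div_div]
    gcongr

lemma abs_expansion_sub_le_of_agree_from (hb : 2 ≤ b) (N : ℕ) {a c : ℕ → ℕ}
    (ha : ∀ i, a i < b) (hc : ∀ i, c i < b) (h : ∀ i, N ≤ i → a i = c i) :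
    |expansion b a - expansion b c| ≤ 1 - 1 / (b : ℝ) ^ N := by
  have hb' : (0 : ℝ) < b := by exact_mod_cast (by omega : 0 < b)
  induction N generalizing a c with
  | zero =>
    have : a = c := funext fun i => h i (Nat.zero_le _)
    simp [this]
  | succ N ih =>
    have := ih (a := fun i => a (i + 1)) (c := fun i => c (i + 1)) (fun i => ha _)
      (fun i => hc _) (fun i hi => h _ (by omega))
    have h1 : (a 0 : ℝ) + 1 ≤ b := by exact_mod_cast ha 0
    have h2 : (c 0 : ℝ) + 1 ≤ b := by exact_mod_cast hc 0
    have h3 : (0 : ℝ) ≤ a 0 := by positivity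
    have h4 : (0 : ℝ) ≤ c 0 := by positivity
    rw [expansion_eq_shift hb ha, expansion_eq_shift hb hc, ← sub_div,
      abs_div, abs_of_pos hb', pow_succ, div_mul_eq_div_div, div_le_iff₀ hb', sub_mul,
      div_mul_cancel₀ _ hb'.ne', one_mul]
    rw [abs_le] at this ⊢
    constructor <;> linarith

lemma eq_of_abs_expansion_sub_lt (hb : 2 ≤ b) (N : ℕ) {a c : ℕ → ℕ}
    (ha : ∀ i, a i < b) (hc : ∀ i, c i < b) (h : ∀ i, N ≤ i → a i = c i)
    (hlt : |expansion b a - expansion b c| < 1 / (b : ℝ) ^ N) : a = c := by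
  have hb' : (0 : ℝ) < b := by exact_mod_cast (by omega : 0 < b)
  induction N generalizing a c with
  | zero => exact funext fun i => h i (Nat.zero_le _)
  | succ N ih =>
    have htail := abs_expansion_sub_le_of_agree_from hb N (a := fun i => a (i + 1))
      (c := fun i => c (i + 1)) (fun i => ha _) (fun i => hc _) (fun i hi => h _ (by omega))
    rw [expansion_eq_shift hb ha, expansion_eq_shift hb hc, ← sub_div,
      abs_div, abs_of_pos hb', pow_succ, div_mul_eq_div_div, div_lt_div_iff_of_pos_right hb'] at hlt
    have h0 : a 0 = c 0 := by
      have h1 : |((a 0 : ℤ) - (c 0 : ℤ) : ℝ)| < 1 := by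
        push_cast
        rw [abs_le] at htail
        rw [abs_lt] at hlt ⊢
        constructor <;> linarith
      have h2 : |(a 0 : ℤ) - (c 0 : ℤ)| < 1 := by exact_mod_cast h1
      have := Int.abs_lt_one_iff.mp h2
      omega
    rw [h0, add_sub_add_left_eq_sub] at hlt
    have hs := ih (a := fun i => a (i + 1)) (c := fun i => c (i + 1)) (fun i => ha _)
      (fun i => hc _) (fun i hi => h _ (by omega)) hlt
    funext i
    cases i with
    | zero => exact h0
    | succ i => exact congrFun hs i

end Expansion

lemma abs_coord_sub_le_dist (z w : EuclideanSpace ℝ (Fin 2)) (i : Fin 2) :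
    |z i - w i| ≤ dist z w := by
  rw [EuclideanSpace.dist_eq]
  refine Real.le_sqrt_of_sq_le ?_
  simpa [Real.dist_eq] using
    Finset.single_le_sum (f := fun j => dist (z j) (w j) ^ 2) (fun j _ => sq_nonneg _)
      (Finset.mem_univ i)

lemma dist_lt_two_mul_of_abs_coord_sub_le {z w : EuclideanSpace ℝ (Fin 2)} {d : ℝ} (hd : 0 < d)
    (h : ∀ i, |z i - w i| ≤ d) : dist z w < 2 * d := by
  rw [EuclideanSpace.dist_eq, Real.sqrt_lt' (by positivity), Fin.sum_univ_two, Real.dist_eq,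
    Real.dist_eq]
  have h0 := pow_le_pow_left₀ (abs_nonneg _) (h 0) 2
  have h1 := pow_le_pow_left₀ (abs_nonneg _) (h 1) 2
  nlinarith

/-- The plane satisfies the covering condition of the Assouad dimension with exponent `2`. -/
lemma exists_cover_ball_plane (x : EuclideanSpace ℝ (Fin 2)) {r R : ℝ} (hr : 0 < r) (hR : r ≤ R) :
    ∃ F : Finset (EuclideanSpace ℝ (Fin 2)), (F.card : ℝ) ≤ 49 * (R / r) ^ (2 : ℝ) ∧
      ball x R ⊆ ⋃ y ∈ F, ball y r := by
  classical
  set N : ℕ := ⌈2 * R / r⌉₊ with hN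
  have hR0 : 0 < R := hr.trans_le hR
  have hRr : 1 ≤ R / r := (one_le_div hr).2 hR
  let f : ℤ × ℤ → EuclideanSpace ℝ (Fin 2) :=
    fun p => !₂[x 0 + p.1 * (r / 2), x 1 + p.2 * (r / 2)]
  let I : Finset ℤ := Finset.Icc (-(N : ℤ)) N
  have hmem : ∀ z ∈ ball x R, ∀ i, ⌊(z i - x i) / (r / 2)⌋ ∈ I := by
    intro z hz i
    have h1 := (abs_coord_sub_le_dist z x i).trans_lt hz
    have h2 : |(z i - x i) / (r / 2)| < 2 * R / r := by
      rw [abs_div, abs_of_pos (half_pos hr), div_lt_div_iff₀ (half_pos hr) hr]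
      nlinarith
    have h3 : 2 * R / r ≤ (N : ℝ) := Nat.le_ceil _
    rw [abs_lt] at h2
    rw [Finset.mem_Icc]
    constructor
    · rw [Int.le_floor]
      push_cast
      linarith
    · have : ((⌊(z i - x i) / (r / 2)⌋ : ℤ) : ℝ) ≤ ((N : ℤ) : ℝ) := by
        push_cast
        linarith [Int.floor_le ((z i - x i) / (r / 2))]
      exact_mod_cast this
  have hclose : ∀ (z : EuclideanSpace ℝ (Fin 2)) (i : Fin 2),
      |z i - (x i + (⌊(z i - x i) / (r / 2)⌋ : ℝ) * (r / 2))| ≤ r / 2 := by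
    intro z i
    have h1 := Int.floor_le ((z i - x i) / (r / 2))
    have h2 := (Int.lt_floor_add_one ((z i - x i) / (r / 2))).le
    rw [le_div_iff₀ (half_pos hr)] at h1
    rw [div_le_iff₀ (half_pos hr)] at h2
    rw [abs_le]
    constructor <;> linarith
  refine ⟨(I ×ˢ I).image f, ?_, fun z hz => ?_⟩
  · have hI : I.card = 2 * N + 1 := by
      rw [Int.card_Icc]
      omega
    have hNle : (N : ℝ) ≤ 3 * (R / r) := by
      have := (Nat.ceil_lt_add_one (show 0 ≤ 2 * R / r by positivity)).le
      rw [mul_div_assoc] at this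
      rw [hN, mul_div_assoc]
      linarith
    have hcard : (((I ×ˢ I).image f).card : ℝ) ≤ (2 * N + 1) * (2 * N + 1) := by
      have := Finset.card_image_le (s := I ×ˢ I) (f := f)
      rw [Finset.card_product, hI] at this
      exact_mod_cast this
    rw [show (2 : ℝ) = ((2 : ℕ) : ℝ) by norm_num, Real.rpow_natCast]
    have h0 : (0 : ℝ) ≤ N := by positivity
    nlinarith
  · refine mem_iUnion₂.2 ⟨f (⌊(z 0 - x 0) / (r / 2)⌋, ⌊(z 1 - x 1) / (r / 2)⌋),
      Finset.mem_image_of_mem _ (Finset.mk_mem_product (hmem z hz 0) (hmem z hz 1)), ?_⟩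
    have := dist_lt_two_mul_of_abs_coord_sub_le (half_pos hr)
      (z := z) (w := f (⌊(z 0 - x 0) / (r / 2)⌋, ⌊(z 1 - x 1) / (r / 2)⌋)) (fun i => by
        fin_cases i
        · simpa [f] using hclose z 0
        · simpa [f] using hclose z 1)
    rw [mem_ball]
    linarith

/-- A separated family in a set bounds from below the size of any cover by small balls. -/
lemma card_le_card_of_separated {X ι : Type*} [PseudoMetricSpace X] [Fintype ι] {f : ι → X} {r : ℝ}
    (hsep : ∀ i j, dist (f i) (f j) < 2 * r → i = j) {F : Finset X}
    (hF : ∀ i, f i ∈ ⋃ y ∈ F, ball y r) : Fintype.card ι ≤ F.card := by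
  classical
  have h : ∀ i, ∃ y : F, f i ∈ ball (y : X) r := fun i => by
    obtain ⟨y, hy, hi⟩ := mem_iUnion₂.1 (hF i)
    exact ⟨⟨y, hy⟩, hi⟩
  choose c hc using h
  rw [← Fintype.card_coe F]
  refine Fintype.card_le_of_injective c fun i j hij => hsep i j ?_
  have h1 := mem_ball.1 (hc i)
  have h2 := mem_ball.1 (hc j)
  rw [← hij] at h2
  linarith [dist_triangle_right (f i) (f j) (c i : X)]

/-- Given `q` and `p` with `n ^ p ≤ m ^ q`, some ball of the carpet contains a separated set of
`t ^ p * s ^ q` points, where the ratio of the radius to the separation is comparable to `m ^ q`. -/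
lemma card_pow_le_of_cover {n m : ℕ} (hm : 2 ≤ m) (hmn : m < n)
    {A : Finset (ℕ × ℕ)} (hAsub : ∀ p ∈ A, p.1 < n ∧ p.2 < m) {j : ℕ} (hj : rowCount A j ≠ 0)
    {α C : ℝ}
    (hcov : ∀ x ∈ bmCarpet n m A, ∀ r R : ℝ, 0 < r → r ≤ R →
      ∃ F : Finset (EuclideanSpace ℝ (Fin 2)), (F.card : ℝ) ≤ C * (R / r) ^ α ∧
        bmCarpet n m A ∩ ball x R ⊆ ⋃ y ∈ F, ball y r)
    {p q : ℕ} (hpq : n ^ p ≤ m ^ q) :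
    ((rowCount A j : ℝ) ^ p * (sVal m A : ℝ) ^ q) ≤ C * (4 * m * (m : ℝ) ^ q) ^ α := by
  classical
  have hn : 2 ≤ n := by omega
  have hm0 : (0 : ℝ) < m := by exact_mod_cast (by omega : 0 < m)
  obtain ⟨k, hk⟩ : ∃ k : ℕ, m ^ (k + p) ≤ n ^ k := by
    obtain ⟨k, hk⟩ := pow_unbounded_of_one_lt ((m : ℝ) ^ p)
      (show (1 : ℝ) < n / m from (one_lt_div hm0).2 (by exact_mod_cast hmn))
    refine ⟨k, ?_⟩
    rw [div_pow, lt_div_iff₀ (by positivity), ← pow_add, add_comm] at hk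
    exact_mod_cast hk.le
  set l := Nat.log m (n ^ k) with hl
  have hnk : n ^ k ≠ 0 := pow_ne_zero _ (by omega)
  have hkl : k + p ≤ l := Nat.le_log_of_pow_le (by omega) hk
  have hml : m ^ l ≤ n ^ k := Nat.pow_log_le_self m hnk
  have hml' : n ^ k < m ^ (l + 1) := Nat.lt_pow_succ_log_self (by omega) _
  have hrow : ∀ i, rowCount A i ≠ 0 → ∃ x, (x, i) ∈ A := by
    intro i hi
    obtain ⟨⟨a, b⟩, hab⟩ := Finset.card_pos.1 (Nat.pos_of_ne_zero hi)
    obtain ⟨h1, rfl⟩ := Finset.mem_filter.1 hab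
    exact ⟨a, h1⟩
  choose! g hg using hrow
  let T := A.filter (fun p => p.2 = j)
  let S := (Finset.range m).filter (fun j => rowCount A j ≠ 0)
  have hjm : j < m := by
    have := hAsub _ (hg j hj)
    exact this.2
  let Y : (Fin q → S) → ℕ → ℕ := fun v i =>
    if h : l ≤ i ∧ i < l + q then (v ⟨i - l, by omega⟩ : ℕ) else j
  let X : (Fin p → T) → (Fin q → S) → ℕ → ℕ := fun u v i =>
    if h : k ≤ i ∧ i < k + p then (u ⟨i - k, by omega⟩ : ℕ × ℕ).1 else g (Y v i)
  have hYrow : ∀ v i, rowCount A (Y v i) ≠ 0 := by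
    intro v i
    by_cases h : l ≤ i ∧ i < l + q
    · simp only [Y, dif_pos h]
      exact (Finset.mem_filter.1 (v ⟨i - l, by omega⟩).2).2
    · simpa only [Y, dif_neg h] using hj
  have hXY : ∀ u v i, (X u v i, Y v i) ∈ A := by
    intro u v i
    by_cases h : k ≤ i ∧ i < k + p
    · have hy : Y v i = j := dif_neg (by omega)
      obtain ⟨h1, h2⟩ := Finset.mem_filter.1 (u ⟨i - k, by omega⟩).2
      simp only [X, dif_pos h, hy]
      rw [← h2]
      exact h1
    · simp only [X, dif_neg h]
      exact hg _ (hYrow v i)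
  have hX : ∀ u v i, X u v i < n := fun u v i => (hAsub _ (hXY u v i)).1
  have hY : ∀ v i, Y v i < m := fun v i => by
    by_cases h : l ≤ i ∧ i < l + q
    · simp only [Y, dif_pos h]
      exact Finset.mem_range.1 (Finset.mem_filter.1 (v ⟨i - l, by omega⟩).2).1
    · simpa only [Y, dif_neg h] using hjm
  let f : (Fin p → T) × (Fin q → S) → EuclideanSpace ℝ (Fin 2) := fun w =>
    !₂[expansion n (X w.1 w.2), expansion m (Y w.2)]
  have hf : ∀ w, f w ∈ bmCarpet n m A := fun w =>
    ⟨X w.1 w.2, Y w.2, hXY _ _, by simp [f, expansion], by simp [f, expansion]⟩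
  have hYl : ∀ v v' i, i < l → Y v i = Y v' i := fun v v' i hi => by
    simp only [Y]
    rw [dif_neg (by omega), dif_neg (by omega)]
  have hdist : ∀ w w', dist (f w) (f w') < 2 * (1 / (m : ℝ) ^ l) := by
    intro w w'
    refine dist_lt_two_mul_of_abs_coord_sub_le (by positivity) fun i => ?_
    fin_cases i
    · refine (abs_expansion_sub_le_of_agree_before hn k (hX _ _) (hX _ _) fun i hi => ?_).trans ?_
      · simp only [X]
        rw [dif_neg (by omega), dif_neg (by omega), hYl _ _ _ (by omega)]
      · exact one_div_le_one_div_of_le (by positivity) (by exact_mod_cast hml)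
    · exact abs_expansion_sub_le_of_agree_before hm l (hY _) (hY _) (hYl _ _)
  set r : ℝ := 1 / (m : ℝ) ^ (l + q + 1) / 2 with hr
  have hr0 : 0 < r := by positivity
  have hsep : ∀ w w', dist (f w) (f w') < 2 * r → w = w' := by
    rintro ⟨u, v⟩ ⟨u', v'⟩ h
    have h2r : 2 * r = 1 / (m : ℝ) ^ (l + q + 1) := by rw [hr]; ring
    rw [h2r] at h
    have h0 : |expansion n (X u v) - expansion n (X u' v')| < 1 / (m : ℝ) ^ (l + q + 1) :=
      (abs_coord_sub_le_dist (f (u, v)) (f (u', v')) 0).trans_lt h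
    have h1 : |expansion m (Y v) - expansion m (Y v')| < 1 / (m : ℝ) ^ (l + q + 1) :=
      (abs_coord_sub_le_dist (f (u, v)) (f (u', v')) 1).trans_lt h
    have hYY : Y v = Y v' := by
      refine eq_of_abs_expansion_sub_lt hm (l + q + 1) (hY _) (hY _) (fun i hi => ?_) h1
      simp only [Y]
      rw [dif_neg (by omega), dif_neg (by omega)]
    have hXX : X u v = X u' v' := by
      refine eq_of_abs_expansion_sub_lt hn (k + p) (hX _ _) (hX _ _) (fun i hi => ?_)
        (h0.trans_le ?_)
      · simp only [X]
        rw [dif_neg (by omega), dif_neg (by omega), hYY]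
      · have : n ^ (k + p) ≤ m ^ (l + q + 1) := by
          rw [pow_add, show l + q + 1 = l + 1 + q by ring, pow_add m]
          exact Nat.mul_le_mul hml'.le hpq
        exact one_div_le_one_div_of_le (by positivity) (by exact_mod_cast this)
    refine Prod.ext (funext fun i => Subtype.ext (Prod.ext ?_ ?_))
      (funext fun i => Subtype.ext ?_)
    · have := congrFun hXX (k + i)
      simp only [X] at this
      rw [dif_pos (by omega), dif_pos (by omega)] at this
      simpa using this
    · rw [(Finset.mem_filter.1 (u i).2).2, (Finset.mem_filter.1 (u' i).2).2]
    · have := congrFun hYY (l + i)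
      simp only [Y] at this
      rw [dif_pos (by omega), dif_pos (by omega)] at this
      simpa using this
  have hT : T.Nonempty := Finset.card_pos.1 (Nat.pos_of_ne_zero hj)
  let w₀ : (Fin p → T) × (Fin q → S) := (fun _ => ⟨hT.choose, hT.choose_spec⟩,
    fun _ => ⟨j, Finset.mem_filter.2 ⟨Finset.mem_range.2 hjm, hj⟩⟩)
  have hRr : 2 * (1 / (m : ℝ) ^ l) / r = 4 * m * (m : ℝ) ^ q := by
    rw [hr, pow_succ, pow_add]
    field_simp
    ring
  have hrR : r ≤ 2 * (1 / (m : ℝ) ^ l) := by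
    rw [← one_le_div hr0, hRr]
    have h1 : (1 : ℝ) ≤ m := by exact_mod_cast (by omega : 1 ≤ m)
    have h2 : (1 : ℝ) ≤ (m : ℝ) ^ q := one_le_pow₀ h1
    nlinarith
  obtain ⟨F, hFcard, hF⟩ := hcov (f w₀) (hf w₀) r _ hr0 hrR
  have hcard := card_le_card_of_separated hsep
    (fun w => hF ⟨hf w, mem_ball.2 (hdist w w₀)⟩)
  rw [hRr] at hFcard
  refine le_trans ?_ hFcard
  have hι : Fintype.card ((Fin p → T) × (Fin q → S)) = rowCount A j ^ p * sVal m A ^ q := by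
    rw [Fintype.card_prod, Fintype.card_fun, Fintype.card_fun, Fintype.card_fin, Fintype.card_fin,
      Fintype.card_coe, Fintype.card_coe]
    rfl
  rw [hι] at hcard
  exact_mod_cast hcard

lemma logb_add_logb_le_of_pow_le {n m s t : ℕ} (hm : 2 ≤ m) (hn : 2 ≤ n) (hs : 0 < s) (ht : 0 < t)
    {α C : ℝ} (hC : 0 < C)
    (h : ∀ p q : ℕ, n ^ p ≤ m ^ q →
      (t : ℝ) ^ p * (s : ℝ) ^ q ≤ C * (4 * m * (m : ℝ) ^ q) ^ α) :
    Real.logb m s + Real.logb n t ≤ α := by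
  have hm0 : (0 : ℝ) < m := by exact_mod_cast (by omega : 0 < m)
  have hs0 : (0 : ℝ) < s := by exact_mod_cast hs
  have ht0 : (0 : ℝ) < t := by exact_mod_cast ht
  have hlm : 0 < Real.log m := Real.log_pos (by exact_mod_cast (by omega : 1 < m))
  have hln : 0 < Real.log n := Real.log_pos (by exact_mod_cast (by omega : 1 < n))
  have hlt : 0 ≤ Real.log t := Real.log_nonneg (by exact_mod_cast ht)
  set D : ℝ := Real.log C + α * Real.log (4 * m) + Real.log t with hD
  have key : ∀ q : ℕ,
      q * ((Real.logb m s + Real.logb n t - α) * Real.log m) ≤ D := by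
    intro q
    set p := ⌊q * Real.log m / Real.log n⌋₊ with hp
    have hp1 : p * Real.log n ≤ q * Real.log m := by
      rw [← le_div_iff₀ hln]
      exact Nat.floor_le (by positivity)
    have hp2 : q * Real.log m / Real.log n ≤ p + 1 := (Nat.lt_floor_add_one _).le
    have hpq : n ^ p ≤ m ^ q := by
      have : ((n : ℝ) ^ p) ≤ (m : ℝ) ^ q := by
        rw [← Real.log_le_log_iff (by positivity) (by positivity), Real.log_pow, Real.log_pow]
        exact hp1
      exact_mod_cast this
    have h1 := Real.log_le_log (by positivity) (h p q hpq)
    rw [Real.log_mul (by positivity) (by positivity), Real.log_mul (by positivity) (by positivity),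
      Real.log_rpow (by positivity), Real.log_mul (by positivity) (by positivity),
      Real.log_pow, Real.log_pow, Real.log_pow] at h1
    have h2 := mul_le_mul_of_nonneg_right hp2 hlt
    have h3 : q * ((Real.logb m s + Real.logb n t - α) * Real.log m) =
        q * Real.log s + q * Real.log m / Real.log n * Real.log t - α * (q * Real.log m) := by
      rw [Real.logb, Real.logb]
      field_simp
    rw [h3, hD]
    linarith
  by_contra! hlt'
  have hpos : 0 < (Real.logb m s + Real.logb n t - α) * Real.log m :=
    mul_pos (by linarith) hlm
  obtain ⟨q, hq⟩ := exists_nat_gt (D / ((Real.logb m s + Real.logb n t - α) * Real.log m))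
  rw [div_lt_iff₀ hpos] at hq
  exact absurd (key q) (not_le.2 hq)

/-- For `n > m ≥ 2` and non-empty `A ⊆ {0,…,n−1} × {0,…,m−1}`, the
Assouad dimension of the Bedford–McMullen carpet `S(A)` is at least `log_m s + log_n t`. -/
theorem bm_assouadDim_ge (n m : ℕ) (hm : 2 ≤ m) (hmn : m < n)
    (A : Finset (ℕ × ℕ)) (hA : A.Nonempty)
    (hAsub : ∀ p ∈ A, p.1 < n ∧ p.2 < m) :
    Real.logb m (sVal m A) + Real.logb n (tVal m A) ≤
      assouadDim (bmCarpet n m A) := by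
  obtain ⟨a, ha⟩ := hA
  have ham : a.2 ∈ Finset.range m := Finset.mem_range.2 (hAsub a ha).2
  have harow : 0 < rowCount A a.2 := Finset.card_pos.2 ⟨a, Finset.mem_filter.2 ⟨ha, rfl⟩⟩
  obtain ⟨j, -, hj⟩ := Finset.exists_mem_eq_sup (Finset.range m) ⟨_, ham⟩ (rowCount A)
  have ht : tVal m A = rowCount A j := hj
  have ht0 : 0 < tVal m A :=
    harow.trans_le (Finset.le_sup (f := fun j => rowCount A j) ham)
  have hs0 : 0 < sVal m A :=
    Finset.card_pos.2 ⟨a.2, Finset.mem_filter.2 ⟨ham, harow.ne'⟩⟩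
  refine le_csInf ⟨2, by norm_num, 49, by norm_num, fun x _ r R hr hR => ?_⟩ ?_
  · obtain ⟨F, hFcard, hF⟩ := exists_cover_ball_plane x hr hR
    exact ⟨F, hFcard, inter_subset_right.trans hF⟩
  · rintro α ⟨-, C, hC, hcov⟩
    refine logb_add_logb_le_of_pow_le hm (by omega) hs0 ht0 hC fun p q hpq => ?_
    rw [ht] at ht0 ⊢
    exact card_pow_le_of_cover hm hmn hAsub ht0.ne' hcov hpq
end

section
/- Fix a compact subset X of ℝ² and a compact subset U of X. Suppose that for each k ∈ ℕ there is a set U_k ⊆ ℝ² that is the image of U under a similarity transformation of ℝ² (a map f with |f(a)−f(b)| = λ|a−b| for all a,b, for some λ > 0, possibly depending on k), and suppose that the sets U_k ∩ X converge in the Hausdorff distance to a set ŝU ⊆ X. Then dim_A(ŝU) ≤ dim_A(U). -/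
open Set Metric Filter

/-- A proper real normed space is doubling: every ball is covered by a uniformly bounded number of
balls of half its radius. The bound is recorded as a power of two. -/
theorem exists_ball_subset_iUnion_ball_half (E : Type*) [NormedAddCommGroup E] [NormedSpace ℝ E]
    [ProperSpace E] :
    ∃ m : ℕ, ∀ (x : E) (R : ℝ), 0 < R →
      ∃ F : Finset E, F.card ≤ 2 ^ m ∧ ball x R ⊆ ⋃ y ∈ F, ball y (R / 2) := by
  classical
  obtain ⟨t, -, ht, hcov⟩ := (isCompact_closedBall (0 : E) 1).finite_cover_balls
    (show (0 : ℝ) < 1 / 2 by norm_num)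
  refine ⟨ht.toFinset.card, fun x R hR => ⟨ht.toFinset.image fun c => x + R • c,
    Finset.card_image_le.trans Nat.lt_two_pow_self.le, fun z hz => ?_⟩⟩
  have hz' : R⁻¹ • (z - x) ∈ closedBall (0 : E) 1 := by
    rw [mem_closedBall_zero_iff, norm_smul, Real.norm_of_nonneg (inv_nonneg.2 hR.le),
      inv_mul_le_iff₀ hR, mul_one]
    exact (mem_ball_iff_norm.1 hz).le
  obtain ⟨c, hc, hzc⟩ := mem_iUnion₂.1 (hcov hz')
  refine mem_iUnion₂.2 ⟨x + R • c, Finset.mem_image_of_mem _ (ht.mem_toFinset.2 hc), ?_⟩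
  have key : z - (x + R • c) = R • (R⁻¹ • (z - x) - c) := by
    rw [smul_sub, smul_inv_smul₀ hR.ne', sub_sub]
  rw [mem_ball_iff_norm] at hzc ⊢
  rw [key, norm_smul, Real.norm_of_nonneg hR.le]
  linarith [mul_lt_mul_of_pos_left hzc hR]

theorem exists_ball_subset_iUnion_ball_div_two_pow {E : Type*} [PseudoMetricSpace E] {N : ℕ}
    (hN : ∀ (x : E) (R : ℝ), 0 < R →
      ∃ F : Finset E, F.card ≤ N ∧ ball x R ⊆ ⋃ y ∈ F, ball y (R / 2))
    (n : ℕ) (x : E) {R : ℝ} (hR : 0 < R) :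
    ∃ F : Finset E, F.card ≤ N ^ n ∧ ball x R ⊆ ⋃ y ∈ F, ball y (R / 2 ^ n) := by
  classical
  induction n with
  | zero => exact ⟨{x}, by simp, by simp⟩
  | succ n ih =>
    obtain ⟨F, hF, hcov⟩ := ih
    choose G hG hGcov using fun y => hN y (R / 2 ^ n) (by positivity)
    refine ⟨F.biUnion G, ?_, fun z hz => ?_⟩
    · rw [pow_succ]
      exact (Finset.card_biUnion_le_card_mul F G N fun y _ => hG y).trans
        (Nat.mul_le_mul_right N hF)
    · obtain ⟨y, hy, hzy⟩ := mem_iUnion₂.1 (hcov hz)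
      obtain ⟨c, hc, hzc⟩ := mem_iUnion₂.1 (hGcov y hzy)
      refine mem_iUnion₂.2 ⟨c, Finset.mem_biUnion.2 ⟨y, hy, hc⟩, ?_⟩
      rwa [pow_succ, ← div_div]

/-- `α` is an admissible exponent in the definition of `assouadDim E`. -/
def IsAssouadExponent {X : Type*} [PseudoMetricSpace X] (E : Set X) (α : ℝ) : Prop :=
  0 ≤ α ∧ ∃ C : ℝ, 0 < C ∧ ∀ x ∈ E, ∀ r R : ℝ, 0 < r → r ≤ R →
    ∃ F : Finset X, (F.card : ℝ) ≤ C * (R / r) ^ α ∧ E ∩ ball x R ⊆ ⋃ y ∈ F, ball y r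

theorem assouadDim_le_of_forall_isAssouadExponent {X Y : Type*} [PseudoMetricSpace X]
    [PseudoMetricSpace Y] {A : Set X} {B : Set Y} (hB : ∃ α, IsAssouadExponent B α)
    (h : ∀ α, IsAssouadExponent B α → IsAssouadExponent A α) :
    assouadDim A ≤ assouadDim B :=
  csInf_le_csInf ⟨0, fun _ hα => hα.1⟩ hB h

theorem exists_isAssouadExponent {E : Type*} [NormedAddCommGroup E] [NormedSpace ℝ E]
    [ProperSpace E] (A : Set E) : ∃ α, IsAssouadExponent A α := by
  obtain ⟨m, hm⟩ := exists_ball_subset_iUnion_ball_half E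
  refine ⟨m, m.cast_nonneg, 2 ^ m, by positivity, fun x _ r R hr hrR => ?_⟩
  obtain ⟨n, hn, hn'⟩ := exists_nat_pow_near ((one_le_div hr).2 hrR) one_lt_two
  obtain ⟨F, hF, hcov⟩ :=
    exists_ball_subset_iUnion_ball_div_two_pow hm (n + 1) x (hr.trans_le hrR)
  refine ⟨F, ?_, inter_subset_right.trans (hcov.trans ?_)⟩
  · rw [Real.rpow_natCast]
    calc (F.card : ℝ) ≤ (2 ^ m) ^ (n + 1) := mod_cast hF
      _ = 2 ^ m * (2 ^ n) ^ m := by ring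
      _ ≤ 2 ^ m * (R / r) ^ m := by gcongr
  · refine iUnion₂_mono fun y _ => ball_subset_ball ?_
    rw [div_le_iff₀ (by positivity)]
    rw [div_lt_iff₀ hr] at hn'
    linarith

/-- An admissible exponent for `U` is admissible for any set contained, up to arbitrarily small
errors, in similar copies of `U`. -/
theorem IsAssouadExponent.of_approx_similar {X Y : Type*} [PseudoMetricSpace X]
    [PseudoMetricSpace Y] {U : Set X} {V : Set Y} {α : ℝ} (hU : IsAssouadExponent U α)
    (h : ∀ ε : ℝ, 0 < ε → ∃ (g : X → Y) (c : ℝ), 0 < c ∧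
      (∀ a b, dist (g a) (g b) = c * dist a b) ∧ ∀ z ∈ V, ∃ u ∈ U, dist z (g u) < ε) :
    IsAssouadExponent V α := by
  classical
  obtain ⟨hα, C, hC, hcov⟩ := hU
  refine ⟨hα, C * 4 ^ α, by positivity, fun x hx r R hr hrR => ?_⟩
  obtain ⟨g, c, hc, hg, happrox⟩ := h (r / 2) (by positivity)
  obtain ⟨u, hu, hxu⟩ := happrox x hx
  obtain ⟨F, hF, hFcov⟩ := hcov u hu (r / 2 / c) ((R + r) / c) (by positivity)
    (by gcongr; linarith)
  refine ⟨F.image g, ?_, fun z hz => ?_⟩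
  · have hR : 0 < R := hr.trans_le hrR
    calc ((F.image g).card : ℝ) ≤ F.card := mod_cast Finset.card_image_le
      _ ≤ C * ((R + r) / c / (r / 2 / c)) ^ α := hF
      _ ≤ C * (4 * (R / r)) ^ α := by
        gcongr
        rw [div_div_div_cancel_right₀ hc.ne', ← mul_div_assoc, div_le_div_iff₀ (by positivity) hr]
        nlinarith
      _ = C * 4 ^ α * (R / r) ^ α := by
        rw [Real.mul_rpow (by norm_num) (by positivity), mul_assoc]
  · obtain ⟨v, hv, hzv⟩ := happrox z hz.1
    have hvu : v ∈ ball u ((R + r) / c) := by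
      rw [mem_ball, lt_div_iff₀ hc, mul_comm, ← hg]
      linarith [dist_triangle4 (g v) z x (g u), mem_ball.1 hz.2, dist_comm z (g v)]
    obtain ⟨y, hy, hvy⟩ := mem_iUnion₂.1 (hFcov ⟨hv, hvu⟩)
    refine mem_iUnion₂.2 ⟨g y, Finset.mem_image_of_mem g hy, ?_⟩
    rw [mem_ball, lt_div_iff₀ hc, mul_comm, ← hg] at hvy
    exact mem_ball.2 (by linarith [dist_triangle z (g v) (g y)])

/-- Let `X ⊆ ℝ²` be compact and `U ⊆ X` compact.  Suppose each `U_k` is the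
image of `U` under a similarity `f k` of the plane (with ratio `lam k > 0`), and that
`U_k ∩ X` converges in the Hausdorff distance to `Û ⊆ X`.  Then `dim_A Û ≤ dim_A U`. -/
theorem assouadDim_weak_tangent_le
    (X U : Set (EuclideanSpace ℝ (Fin 2))) (hX : IsCompact X) (hU : IsCompact U)
    (hUX : U ⊆ X)
    (Uk : ℕ → Set (EuclideanSpace ℝ (Fin 2)))
    (f : ℕ → EuclideanSpace ℝ (Fin 2) → EuclideanSpace ℝ (Fin 2))
    (lam : ℕ → ℝ) (hlam : ∀ k, 0 < lam k)
    (hf : ∀ k a b, dist (f k a) (f k b) = lam k * dist a b)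
    (hUk : ∀ k, Uk k = f k '' U)
    (Uhat : Set (EuclideanSpace ℝ (Fin 2))) (hUhatX : Uhat ⊆ X)
    (hconv : Filter.Tendsto (fun k => EMetric.hausdorffEdist (Uk k ∩ X) Uhat)
      Filter.atTop (nhds 0)) :
    assouadDim Uhat ≤ assouadDim U := by
  refine assouadDim_le_of_forall_isAssouadExponent (exists_isAssouadExponent U) fun α hα =>
    hα.of_approx_similar fun ε hε => ?_
  obtain ⟨k, hk⟩ := (hconv.eventually_lt_const (ENNReal.ofReal_pos.2 hε)).exists
  refine ⟨f k, lam k, hlam k, hf k, fun z hz => ?_⟩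
  obtain ⟨y, hy, hzy⟩ :=
    exists_edist_lt_of_hausdorffEDist_lt hz (hausdorffEDist_comm.trans_lt hk)
  obtain ⟨u, hu, rfl⟩ := hUk k ▸ hy.1
  exact ⟨u, hu, edist_lt_ofReal.1 hzy⟩
end

section
/- Let n > m ≥ 2 be integers and A ⊆ {0,1,…,n−1} × {0,1,…,m−1} a non-empty set with s < m, and let S = S(A) be the Bedford–McMullen carpet. Fix k ∈ ℕ and let z_0, z_1, …, z_N be a finite sequence of points of S with |z_i − z_{i+1}| ≤ (1/2)·m^{−(k+1)} for all 0 ≤ i < N. Let q = ⌊m^k·y(z_0)⌋, where y(·) denotes the second coordinate. Then either y(z_i) ∈ (q·m^{−k}, (q+2)·m^{−k}) for all i, or y(z_i) ∈ ((q−1)·m^{−k}, (q+1)·m^{−k}) for all i; in particular the chain cannot travel vertically more than m^{−k}. -/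
open Set Metric Filter

/-- Scaling a base-`b` expansion by `b ^ k` turns its first `k` digits into a natural number. -/
theorem exists_pow_mul_ofDigits_eq {b : ℕ} (d : ℕ → Fin b) (k : ℕ) :
    ∃ P : ℕ, (b : ℝ) ^ k * Real.ofDigits d = P + Real.ofDigits (fun i => d (i + k)) := by
  have hb : (b : ℝ) ≠ 0 := by exact_mod_cast (Fin.pos (d 0)).ne'
  refine ⟨∑ i ∈ Finset.range k, (d i : ℕ) * b ^ (k - (i + 1)), ?_⟩
  rw [Real.ofDigits_eq_sum_add_ofDigits d k, mul_add, mul_inv_cancel_left₀ (pow_ne_zero k hb),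
    Finset.mul_sum]
  push_cast
  congr 1
  refine Finset.sum_congr rfl fun i hi => ?_
  have hik : i + 1 ≤ k := Finset.mem_range.mp hi
  rw [Real.ofDigitsTerm, pow_sub₀ _ hb hik]
  ring

/-- If the digit `j` is omitted from a base-`b` expansion, the scaled value avoids every interval
`(p + j / b, p + (j + 1) / b)` with `p` an integer. -/
theorem exists_int_pow_mul_ofDigits_mem_Icc {b : ℕ} (d : ℕ → Fin b) {j : ℕ} (hj : j < b)
    (hd : ∀ i, (d i : ℕ) ≠ j) (k : ℕ) :
    ∃ p : ℤ, (b : ℝ) ^ k * Real.ofDigits d ∈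
      Set.Icc (p + ((j : ℝ) + 1) / b) (p + 1 + (j : ℝ) / b) := by
  have hb : (0 : ℝ) < b := by exact_mod_cast Fin.pos (d 0)
  obtain ⟨P, hP⟩ := exists_pow_mul_ofDigits_eq d k
  have hsplit : Real.ofDigits (fun i => d (i + k)) =
      ((d k : ℕ) + Real.ofDigits (fun i => d (i + 1 + k))) / b := by
    rw [Real.ofDigits_eq_sum_add_ofDigits (fun i => d (i + k)) 1]
    simp only [Finset.range_one, Finset.sum_singleton, Real.ofDigitsTerm, zero_add, pow_one]
    ring
  have h0 := Real.ofDigits_nonneg (fun i => d (i + k))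
  have h1 := Real.ofDigits_le_one (fun i => d (i + k))
  have t0 := Real.ofDigits_nonneg (fun i => d (i + 1 + k))
  have t1 := Real.ofDigits_le_one (fun i => d (i + 1 + k))
  rw [hP]
  rcases lt_or_gt_of_ne (hd k) with h | h
  · have hle : Real.ofDigits (fun i => d (i + k)) ≤ (j : ℝ) / b := by
      rw [hsplit]
      gcongr
      have : ((d k : ℕ) : ℝ) + 1 ≤ j := by exact_mod_cast h
      linarith
    have hj1 : ((j : ℝ) + 1) / b ≤ 1 := by
      rw [div_le_one hb]
      exact_mod_cast hj
    refine ⟨(P : ℤ) - 1, ?_, ?_⟩ <;> push_cast <;> linarith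
  · have hle : ((j : ℝ) + 1) / b ≤ Real.ofDigits (fun i => d (i + k)) := by
      rw [hsplit]
      refine div_le_div_of_nonneg_right ?_ hb.le
      have : (j : ℝ) + 1 ≤ (d k : ℕ) := by exact_mod_cast h
      linarith
    have hj0 : 0 ≤ (j : ℝ) / b := by positivity
    refine ⟨(P : ℤ), ?_, ?_⟩ <;> push_cast <;> linarith

/-- A real sequence with steps at most `ε`, each term of which lies in some integer translate of
`[a, c]`, stays in a single translate when consecutive translates are more than `ε` apart. -/
theorem exists_int_forall_mem_Icc_of_steps {w : ℕ → ℝ} {a c ε : ℝ} {N : ℕ}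
    (hgap : ε < 1 + a - c) (hw : ∀ i ≤ N, ∃ p : ℤ, w i ∈ Set.Icc (p + a) (p + c))
    (hstep : ∀ i < N, |w i - w (i + 1)| ≤ ε) :
    ∃ p : ℤ, ∀ i ≤ N, w i ∈ Set.Icc (p + a) (p + c) := by
  obtain ⟨p, hp⟩ := hw 0 (Nat.zero_le N)
  refine ⟨p, fun i => ?_⟩
  induction i with
  | zero => exact fun _ => hp
  | succ i ih =>
    intro hi
    have hpi := ih (Nat.le_of_succ_le hi)
    obtain ⟨r, hr⟩ := hw (i + 1) hi
    have hs := abs_le.mp (hstep i hi)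
    obtain rfl : r = p := by
      rcases lt_trichotomy r p with h | h | h
      · have : (r : ℝ) + 1 ≤ p := by exact_mod_cast h
        linarith [hpi.1, hr.2]
      · exact h
      · have : (p : ℝ) + 1 ≤ r := by exact_mod_cast h
        linarith [hpi.2, hr.1]
    exact hr

/-- If some row is empty, there is a digit `j < m` which is not a second coordinate in `A`. -/
theorem exists_missing_row {m : ℕ} {A : Finset (ℕ × ℕ)} (hs : sVal m A < m) :
    ∃ j < m, ∀ p ∈ A, p.2 ≠ j := by
  by_contra! h
  refine hs.ne ?_
  rw [sVal, Finset.filter_true_of_mem, Finset.card_range]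
  intro j hj
  obtain ⟨p, hpA, hpj⟩ := h j (Finset.mem_range.mp hj)
  exact Finset.card_ne_zero_of_mem (Finset.mem_filter.mpr ⟨hpA, hpj⟩)

/-- The heights of carpet points, scaled by `m ^ k`, avoid the gaps left by a missing row `j`. -/
theorem exists_int_pow_mul_mem_Icc_of_mem_bmCarpet {n m : ℕ} {A : Finset (ℕ × ℕ)}
    (hAsub : ∀ p ∈ A, p.2 < m) {j : ℕ} (hjm : j < m) (hj : ∀ p ∈ A, p.2 ≠ j) (k : ℕ)
    {z : EuclideanSpace ℝ (Fin 2)} (hz : z ∈ bmCarpet n m A) :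
    ∃ p : ℤ, (m : ℝ) ^ k * z 1 ∈ Set.Icc (p + ((j : ℝ) + 1) / m) (p + (1 + (j : ℝ) / m)) := by
  obtain ⟨x, y, hxy, -, hz1⟩ := hz
  have hz1 : z 1 = Real.ofDigits (fun i => (⟨y i, hAsub _ (hxy i)⟩ : Fin m)) := by
    simp only [hz1, Real.ofDigits, Real.ofDigitsTerm, div_eq_mul_inv]
  rw [hz1]
  simpa only [add_assoc] using exists_int_pow_mul_ofDigits_mem_Icc _ hjm (fun i => hj _ (hxy i)) k

/-- Suppose `s < m`.  Any chain `z_0, …, z_N` in `S` with consecutive gaps at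
most `(1/2) m^{−(k+1)}` has its `y`-coordinates confined either to
`(q m^{−k}, (q+2) m^{−k})` or to `((q−1) m^{−k}, (q+1) m^{−k})`, where
`q = ⌊m^k y(z_0)⌋`; in particular the chain never leaves the `m^{−k}`-neighborhood of the
horizontal band `[q m^{−k}, (q+1) m^{−k}]` containing its starting point. -/
theorem bm_chain_vertical (n m : ℕ) (hm : 2 ≤ m) (hmn : m < n)
    (A : Finset (ℕ × ℕ)) (hA : A.Nonempty)
    (hAsub : ∀ p ∈ A, p.1 < n ∧ p.2 < m)
    (hs : sVal m A < m)
    (k N : ℕ) (z : ℕ → EuclideanSpace ℝ (Fin 2))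
    (hzS : ∀ i ≤ N, z i ∈ bmCarpet n m A)
    (hchain : ∀ i < N, dist (z i) (z (i + 1)) ≤ (1 / 2) * (1 / (m : ℝ) ^ (k + 1))) :
    ((∀ i ≤ N, (z i) 1 ∈
        Set.Ioo ((⌊(m : ℝ) ^ k * (z 0) 1⌋ : ℝ) / (m : ℝ) ^ k)
                (((⌊(m : ℝ) ^ k * (z 0) 1⌋ : ℝ) + 2) / (m : ℝ) ^ k)) ∨
     (∀ i ≤ N, (z i) 1 ∈
        Set.Ioo (((⌊(m : ℝ) ^ k * (z 0) 1⌋ : ℝ) - 1) / (m : ℝ) ^ k)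
                (((⌊(m : ℝ) ^ k * (z 0) 1⌋ : ℝ) + 1) / (m : ℝ) ^ k))) ∧
    (∀ i ≤ N, ∃ u ∈ Set.Icc ((⌊(m : ℝ) ^ k * (z 0) 1⌋ : ℝ) / (m : ℝ) ^ k)
        (((⌊(m : ℝ) ^ k * (z 0) 1⌋ : ℝ) + 1) / (m : ℝ) ^ k),
        |(z i) 1 - u| < 1 / (m : ℝ) ^ k) := by
  obtain ⟨j, hjm, hj⟩ := exists_missing_row hs
  have hm0 : (0 : ℝ) < m := by positivity
  have hmk : (0 : ℝ) < (m : ℝ) ^ k := by positivity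
  obtain ⟨p, hp⟩ := exists_int_forall_mem_Icc_of_steps (w := fun i => (m : ℝ) ^ k * z i 1)
    (a := ((j : ℝ) + 1) / m) (c := 1 + (j : ℝ) / m) (ε := 1 / 2 * (1 / m)) (N := N)
    (by
      have : (0 : ℝ) < 1 / m := by positivity
      rw [add_div]
      linarith)
    (fun i hi => exists_int_pow_mul_mem_Icc_of_mem_bmCarpet (fun p hp => (hAsub p hp).2)
      hjm hj k (hzS i hi))
    (fun i hi => by
      have h : |z i 1 - z (i + 1) 1| ≤ 1 / 2 * (1 / (m : ℝ) ^ (k + 1)) :=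
        (PiLp.norm_apply_le (z i - z (i + 1)) 1).trans (dist_eq_norm (z i) _ ▸ hchain i hi)
      rw [← mul_sub, abs_mul, abs_of_pos hmk]
      calc (m : ℝ) ^ k * |z i 1 - z (i + 1) 1|
          ≤ (m : ℝ) ^ k * (1 / 2 * (1 / (m : ℝ) ^ (k + 1))) := by gcongr
        _ = 1 / 2 * (1 / m) := by
          rw [pow_succ]
          field_simp)
  have ha : (0 : ℝ) < ((j : ℝ) + 1) / m := by positivity
  have hc : (j : ℝ) / m < 1 := by
    rw [div_lt_one hm0]
    exact_mod_cast hjm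
  have hband : ∀ i ≤ N, (p : ℝ) < (m : ℝ) ^ k * z i 1 ∧ (m : ℝ) ^ k * z i 1 < p + 2 :=
    fun i hi => ⟨by linarith [(hp i hi).1], by linarith [(hp i hi).2]⟩
  set q : ℤ := ⌊(m : ℝ) ^ k * (z 0) 1⌋ with hq
  have hqp : q = p ∨ q = p + 1 := by
    obtain ⟨h1, h2⟩ := hband 0 (Nat.zero_le N)
    have hpq : p ≤ q := Int.le_floor.mpr h1.le
    have hqp : q < p + 2 := Int.floor_lt.mpr (by exact_mod_cast h2)
    omega
  have hdisj : (∀ i ≤ N, (z i) 1 ∈ Set.Ioo ((q : ℝ) / (m : ℝ) ^ k) ((q + 2) / (m : ℝ) ^ k)) ∨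
      (∀ i ≤ N, (z i) 1 ∈ Set.Ioo (((q : ℝ) - 1) / (m : ℝ) ^ k) ((q + 1) / (m : ℝ) ^ k)) := by
    simp only [Set.mem_Ioo, div_lt_iff₀' hmk, lt_div_iff₀' hmk]
    rcases hqp with h | h
    · exact Or.inl fun i hi => h ▸ hband i hi
    · right
      intro i hi
      obtain ⟨h1, h2⟩ := hband i hi
      rw [h]
      push_cast
      constructor <;> linarith
  refine ⟨hdisj, fun i hi => ?_⟩
  have hpos : (0 : ℝ) < 1 / (m : ℝ) ^ k := by positivity
  have htwo : (2 : ℝ) / (m : ℝ) ^ k = 1 / (m : ℝ) ^ k + 1 / (m : ℝ) ^ k := by ring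
  have hwide : (q : ℝ) / (m : ℝ) ^ k - 1 / (m : ℝ) ^ k < z i 1 ∧
      z i 1 < (q : ℝ) / (m : ℝ) ^ k + 2 / (m : ℝ) ^ k := by
    simp only [Set.mem_Ioo, add_div, sub_div] at hdisj
    rcases hdisj with h | h <;> obtain ⟨h1, h2⟩ := h i hi <;> constructor <;> linarith
  rw [add_div]
  rcases lt_or_ge (z i 1) ((q : ℝ) / (m : ℝ) ^ k) with h | h
  · refine ⟨_, Set.left_mem_Icc.mpr (by linarith), ?_⟩
    rw [abs_lt]
    constructor <;> linarith [hwide.1]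
  rcases le_or_gt (z i 1) ((q : ℝ) / (m : ℝ) ^ k + 1 / (m : ℝ) ^ k) with h' | h'
  · exact ⟨z i 1, ⟨h, h'⟩, by simpa using hmk⟩
  · refine ⟨_, Set.right_mem_Icc.mpr (by linarith), ?_⟩
    rw [abs_lt]
    constructor <;> linarith [hwide.2]
end

section
/- Let n > m ≥ 2 be integers and A ⊆ {0,1,…,n−1} × {0,1,…,m−1} a non-empty set such that the fibers are not uniform, i.e. there exist rows j, j′ with t_j ≥ 1, t_{j′} ≥ 1 and t_j ≠ t_{j′}. Then the Bedford–McMullen carpet S = S(A) satisfies dim_H(S) < \overline{dim}_M(S) < dim_A(S), where dim_H denotes Hausdorff dimension. -/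
open Set Metric Filter

/-- The minimal number of balls of radius `ε` needed to cover `E`
(the infimum over cardinalities of finite centre sets whose `ε`-balls cover `E`). -/
noncomputable def coveringNumber {X : Type*} [PseudoMetricSpace X] (E : Set X) (ε : ℝ) : ℕ :=
  sInf { N : ℕ | ∃ F : Finset X, F.card = N ∧ E ⊆ ⋃ y ∈ F, Metric.ball y ε }

/-- The upper Minkowski dimension of a bounded set:
`limsup_{ε → 0⁺} log N(ε) / log (1/ε)`. -/
noncomputable def upperMinkowskiDim {X : Type*} [PseudoMetricSpace X] (E : Set X) : ℝ :=
  Filter.limsup (fun ε : ℝ => Real.log (coveringNumber E ε) / Real.log (1 / ε))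
    (nhdsWithin 0 (Set.Ioi 0))

namespace BedfordMcMullen

/-! ### Base-`b` expansions -/

/-- The real number with base-`b` digits `d`. -/
noncomputable def expansion (b : ℕ) (d : ℕ → ℕ) : ℝ := ∑' i : ℕ, (d i : ℝ) / (b : ℝ) ^ (i + 1)

/-- The integer with the leading `q` base-`b` digits of `d`. -/
def leadingInt (b : ℕ) (d : ℕ → ℕ) : ℕ → ℕ
  | 0 => 0
  | q + 1 => b * leadingInt b d q + d q

lemma digit_term_le {b : ℕ} (hb : 2 ≤ b) {d : ℕ → ℕ} (hd : ∀ i, d i < b) (i : ℕ) :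
    (d i : ℝ) / (b : ℝ) ^ (i + 1) ≤ ((b : ℝ) - 1) / b * ((b : ℝ)⁻¹) ^ i := by
  have hb' : (0 : ℝ) < b := by positivity
  have h1 : (d i : ℝ) ≤ b - 1 := by
    have : (d i : ℝ) + 1 ≤ b := by exact_mod_cast hd i
    linarith
  rw [inv_pow, ← div_eq_mul_inv, div_div, ← pow_succ']
  gcongr

lemma hasSum_digit_bound {b : ℕ} (hb : 2 ≤ b) :
    HasSum (fun i : ℕ => ((b : ℝ) - 1) / b * ((b : ℝ)⁻¹) ^ i) 1 := by
  have hb' : (2 : ℝ) ≤ b := by exact_mod_cast hb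
  have h := (hasSum_geometric_of_lt_one (r := (b : ℝ)⁻¹) (by positivity)
    (inv_lt_one_of_one_lt₀ (by linarith))).mul_left (((b : ℝ) - 1) / b)
  have h1 : (b : ℝ) - 1 ≠ 0 := by linarith
  have h2 : (b : ℝ) ≠ 0 := by linarith
  have h3 : 1 - (b : ℝ)⁻¹ = (b - 1) / b := by field_simp
  rwa [h3, mul_inv_cancel₀ (div_ne_zero h1 h2)] at h

lemma summable_expansion {b : ℕ} (hb : 2 ≤ b) {d : ℕ → ℕ} (hd : ∀ i, d i < b) :
    Summable fun i : ℕ => (d i : ℝ) / (b : ℝ) ^ (i + 1) :=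
  Summable.of_nonneg_of_le (fun i => by positivity) (digit_term_le hb hd) (hasSum_digit_bound hb).summable

lemma expansion_nonneg (b : ℕ) (d : ℕ → ℕ) : 0 ≤ expansion b d :=
  tsum_nonneg fun i => by positivity

lemma expansion_le_one {b : ℕ} (hb : 2 ≤ b) {d : ℕ → ℕ} (hd : ∀ i, d i < b) :
    expansion b d ≤ 1 :=
  (Summable.tsum_le_tsum (digit_term_le hb hd) (summable_expansion hb hd)
    (hasSum_digit_bound hb).summable).trans_eq (hasSum_digit_bound hb).tsum_eq

lemma expansion_shift {b : ℕ} (hb : 2 ≤ b) {d : ℕ → ℕ} (hd : ∀ i, d i < b) :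
    expansion b d = (d 0 + expansion b fun i => d (i + 1)) / b := by
  have hb' : (b : ℝ) ≠ 0 := by positivity
  rw [expansion, (summable_expansion hb hd).tsum_eq_zero_add, expansion, add_div, ← tsum_div_const]
  congr 1
  · simp
  · refine tsum_congr fun i => ?_
    rw [div_div, ← pow_succ]

lemma mul_expansion {b : ℕ} (hb : 2 ≤ b) {d : ℕ → ℕ} (hd : ∀ i, d i < b) (q : ℕ) :
    (b : ℝ) ^ q * expansion b d = leadingInt b d q + expansion b fun i => d (q + i) := by
  have hb' : (b : ℝ) ≠ 0 := by positivity
  induction q with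
  | zero => simp [leadingInt]
  | succ q ih =>
    rw [pow_succ', mul_assoc, ih, expansion_shift hb (d := fun i => d (q + i)) fun i => hd _]
    simp only [leadingInt]
    push_cast
    have : (fun i => d (q + (i + 1))) = fun i => d (q + 1 + i) := by
      ext i; congr 1; omega
    rw [this]
    field_simp
    simp
    ring

lemma leadingInt_inj {b : ℕ} {d d' : ℕ → ℕ} (hd : ∀ i, d i < b) (hd' : ∀ i, d' i < b) {q : ℕ}
    (h : leadingInt b d q = leadingInt b d' q) : ∀ i < q, d i = d' i := by
  induction q with
  | zero => simp
  | succ q ih =>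
    simp only [leadingInt] at h
    have h1 : d q = d' q := by
      have := congrArg (· % b) h
      simpa [Nat.mul_add_mod, Nat.mod_eq_of_lt, hd, hd'] using this
    have h2 : leadingInt b d q = leadingInt b d' q := by
      rw [h1] at h
      exact Nat.eq_of_mul_eq_mul_left ((Nat.zero_le _).trans_lt (hd 0)) (by omega)
    intro i hi
    rcases Nat.lt_succ_iff_lt_or_eq.mp hi with hi | rfl
    · exact ih h2 i hi
    · exact h1

lemma leadingInt_congr {b : ℕ} {d d' : ℕ → ℕ} {q : ℕ} (h : ∀ i < q, d i = d' i) :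
    leadingInt b d q = leadingInt b d' q := by
  induction q with
  | zero => rfl
  | succ q ih =>
    simp only [leadingInt, ih fun i hi => h i (hi.trans q.lt_succ_self), h q q.lt_succ_self]

lemma leadingInt_le {b : ℕ} (hb : 2 ≤ b) {d : ℕ → ℕ} (hd : ∀ i, d i < b) (q : ℕ) :
    (leadingInt b d q : ℝ) ≤ (b : ℝ) ^ q * expansion b d := by
  rw [mul_expansion hb hd q]
  linarith [expansion_nonneg b fun i => d (q + i)]

lemma le_leadingInt_add_one {b : ℕ} (hb : 2 ≤ b) {d : ℕ → ℕ} (hd : ∀ i, d i < b) (q : ℕ) :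
    (b : ℝ) ^ q * expansion b d ≤ leadingInt b d q + 1 := by
  rw [mul_expansion hb hd q]
  linarith [expansion_le_one hb (d := fun i => d (q + i)) fun i => hd _]

lemma abs_expansion_sub_le {b : ℕ} (hb : 2 ≤ b) {d d' : ℕ → ℕ} (hd : ∀ i, d i < b)
    (hd' : ∀ i, d' i < b) {q : ℕ} (h : ∀ i < q, d i = d' i) :
    |expansion b d - expansion b d'| ≤ ((b : ℝ) ^ q)⁻¹ := by
  have hq : (0 : ℝ) < (b : ℝ) ^ q := by positivity
  have h0 : (leadingInt b d q : ℝ) = leadingInt b d' q := by rw [leadingInt_congr h]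
  have h1 := leadingInt_le hb hd q
  have h2 := le_leadingInt_add_one hb hd q
  have h3 := leadingInt_le hb hd' q
  have h4 := le_leadingInt_add_one hb hd' q
  have hmul : |expansion b d - expansion b d'| * (b : ℝ) ^ q =
      |(expansion b d - expansion b d') * (b : ℝ) ^ q| := by rw [abs_mul, abs_of_pos hq]
  rw [← one_div, le_div_iff₀ hq, hmul, abs_le]
  constructor <;> nlinarith

/-- An expansion close to `c` has a leading integer close to the scaled value of `c`. -/
lemma leadingInt_sub_floor_mem {b : ℕ} (hb : 2 ≤ b) {d : ℕ → ℕ} (hd : ∀ i, d i < b) {q : ℕ}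
    {c r : ℝ} {k : ℕ} (hr : (b : ℝ) ^ q * r ≤ k) (h : |expansion b d - c| ≤ r) :
    (leadingInt b d q : ℤ) - ⌊(b : ℝ) ^ q * c⌋ ∈ Finset.Icc (-(k : ℤ) - 2) (k + 2) := by
  have hq : (0 : ℝ) < (b : ℝ) ^ q := by positivity
  have h1 := leadingInt_le hb hd q
  have h2 := le_leadingInt_add_one hb hd q
  have h3 := Int.floor_le ((b : ℝ) ^ q * c)
  have h4 := Int.lt_floor_add_one ((b : ℝ) ^ q * c)
  obtain ⟨h5, h6⟩ := abs_le.mp h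
  have h7 : (b : ℝ) ^ q * (expansion b d - c) ≤ (b : ℝ) ^ q * r := by gcongr
  have h8 : (b : ℝ) ^ q * (-r) ≤ (b : ℝ) ^ q * (expansion b d - c) := by gcongr
  rw [Finset.mem_Icc]
  constructor
  · have : (-(k : ℝ) - 2) ≤ (leadingInt b d q : ℝ) - ⌊(b : ℝ) ^ q * c⌋ := by linarith
    exact_mod_cast this
  · have : (leadingInt b d q : ℝ) - ⌊(b : ℝ) ^ q * c⌋ ≤ k + 2 := by linarith
    exact_mod_cast this

/-! ### Approximate squares -/

/-- The number of base-`m` digits determining a number at scale `n ^ (-q)`. -/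
def depth (n m q : ℕ) : ℕ := Nat.clog m (n ^ q)

lemma pow_le_pow_depth {m : ℕ} (hm : 2 ≤ m) (n q : ℕ) : n ^ q ≤ m ^ depth n m q :=
  Nat.le_pow_clog (by omega) _

lemma pow_depth_le {n m : ℕ} (hm : 2 ≤ m) (hmn : m < n) (q : ℕ) :
    m ^ depth n m q ≤ m * n ^ q := by
  rcases q.eq_zero_or_pos with rfl | hq
  · simp [depth]; omega
  · have h1 : 1 < n ^ q := Nat.one_lt_pow hq.ne' (by omega)
    have h2 := Nat.pow_pred_clog_lt_self (b := m) (by omega) h1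
    have h3 : 0 < Nat.clog m (n ^ q) := Nat.clog_pos (by omega) h1
    calc m ^ depth n m q = m * m ^ (Nat.clog m (n ^ q)).pred := by
          rw [← pow_succ']; congr 1; simp only [depth]; exact (Nat.succ_pred_eq_of_pos h3).symm
      _ ≤ m * n ^ q := by gcongr

lemma le_depth {n m : ℕ} (hm : 2 ≤ m) (hmn : m < n) (q : ℕ) : q ≤ depth n m q := by
  by_contra! h
  have h1 : m ^ depth n m q ≤ n ^ depth n m q := by gcongr
  have h2 : n ^ depth n m q < n ^ q := Nat.pow_lt_pow_right (by omega) h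
  have h3 := pow_le_pow_depth hm n q
  omega

/-- The exponent `log m / log n`. -/
noncomputable def kappa (n m : ℕ) : ℝ := Real.log m / Real.log n

lemma log_pos_of_two_le {b : ℕ} (hb : 2 ≤ b) : 0 < Real.log b :=
  Real.log_pos (by exact_mod_cast hb)

lemma kappa_pos {n m : ℕ} (hm : 2 ≤ m) (hmn : m < n) : 0 < kappa n m :=
  div_pos (log_pos_of_two_le hm) (log_pos_of_two_le (by omega))

lemma kappa_lt_one {n m : ℕ} (hm : 2 ≤ m) (hmn : m < n) : kappa n m < 1 := by
  rw [kappa, div_lt_one (log_pos_of_two_le (by omega))]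
  exact Real.log_lt_log (by positivity) (by exact_mod_cast hmn)

lemma le_kappa_mul_depth {n m : ℕ} (hm : 2 ≤ m) (hmn : m < n) (q : ℕ) :
    (q : ℝ) ≤ kappa n m * depth n m q := by
  have h : ((n : ℝ)) ^ q ≤ (m : ℝ) ^ depth n m q := by exact_mod_cast pow_le_pow_depth hm n q
  have hn : (0 : ℝ) < n := by exact_mod_cast (by omega : 0 < n)
  have h2 := Real.log_le_log (by positivity) h
  rw [Real.log_pow, Real.log_pow] at h2
  rw [kappa, div_mul_eq_mul_div, le_div_iff₀ (log_pos_of_two_le (by omega))]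
  linarith

lemma kappa_mul_depth_le {n m : ℕ} (hm : 2 ≤ m) (hmn : m < n) (q : ℕ) :
    kappa n m * depth n m q ≤ q + kappa n m := by
  have h : (m : ℝ) ^ depth n m q ≤ m * (n : ℝ) ^ q := by exact_mod_cast pow_depth_le hm hmn q
  have hn : (0 : ℝ) < n := by exact_mod_cast (by omega : 0 < n)
  have hm' : (0 : ℝ) < m := by positivity
  have h2 := Real.log_le_log (by positivity) h
  rw [Real.log_mul (by positivity) (by positivity), Real.log_pow, Real.log_pow] at h2
  have hl : 0 < Real.log n := log_pos_of_two_le (by omega)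
  rw [kappa, div_mul_eq_mul_div, div_le_iff₀ hl, add_mul, div_mul_cancel₀ _ hl.ne']
  linarith

/-- The set of non-empty rows. -/
abbrev rowSet (A : Finset (ℕ × ℕ)) : Finset ℕ := A.image Prod.snd

/-- The row of an element of `A`. -/
def row {A : Finset (ℕ × ℕ)} (a : A) : rowSet A := ⟨a.1.2, Finset.mem_image_of_mem _ a.2⟩

/-- The point of the carpet with a given digit sequence. -/
noncomputable def point (n m : ℕ) {A : Finset (ℕ × ℕ)} (p : ℕ → A) : EuclideanSpace ℝ (Fin 2) :=
  !₂[expansion n fun i => (p i).1.1, expansion m fun i => (p i).1.2]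

lemma bmCarpet_eq_range (n m : ℕ) (A : Finset (ℕ × ℕ)) :
    bmCarpet n m A = range (point n m (A := A)) := by
  ext z
  constructor
  · rintro ⟨x, y, hxy, h0, h1⟩
    refine ⟨fun i => ⟨(x i, y i), hxy i⟩, ?_⟩
    ext i
    fin_cases i
    · exact h0.symm
    · exact h1.symm
  · rintro ⟨p, rfl⟩
    exact ⟨fun i => (p i).1.1, fun i => (p i).1.2, fun i => (p i).2, rfl, rfl⟩

/-- Labels of the approximate squares of side `n ^ (-q)`. -/
abbrev Code (n m : ℕ) (A : Finset (ℕ × ℕ)) (q : ℕ) : Type :=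
  (Fin q → A) × (Fin (depth n m q - q) → rowSet A)

/-- The approximate square of side `n ^ (-q)` containing a given point. -/
def code (n m : ℕ) {A : Finset (ℕ × ℕ)} (q : ℕ) (p : ℕ → A) : Code n m A q :=
  (fun i => p i, fun i => row (p (q + i)))

lemma code_eq_iff {n m : ℕ} (hm : 2 ≤ m) (hmn : m < n) {A : Finset (ℕ × ℕ)} {q : ℕ}
    {p p' : ℕ → A} :
    code n m q p = code n m q p' ↔ (∀ i < q, (p i).1.1 = (p' i).1.1) ∧
      ∀ i < depth n m q, (p i).1.2 = (p' i).1.2 := by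
  have hq := le_depth hm hmn q
  constructor
  · intro h
    have h1 : ∀ i < q, p i = p' i := fun i hi => congrFun (congrArg Prod.fst h) ⟨i, hi⟩
    refine ⟨fun i hi => by rw [h1 i hi], fun i hi => ?_⟩
    by_cases hiq : i < q
    · rw [h1 i hiq]
    · have h2 := congrFun (congrArg Prod.snd h) ⟨i - q, by omega⟩
      have h3 := congrArg Subtype.val h2
      simpa [code, row, Nat.add_sub_cancel' (not_lt.mp hiq)] using h3
  · rintro ⟨h1, h2⟩
    refine Prod.ext (funext fun i => ?_) (funext fun i => ?_)
    · exact Subtype.ext (Prod.ext (h1 i i.2) (h2 i (by omega)))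
    · exact Subtype.ext (h2 (q + i) (by omega))

section Geometry

variable {n m : ℕ} {A : Finset (ℕ × ℕ)}

lemma dist_le_abs_add_abs (z w : EuclideanSpace ℝ (Fin 2)) :
    dist z w ≤ |z 0 - w 0| + |z 1 - w 1| := by
  rw [EuclideanSpace.dist_eq, Fin.sum_univ_two, Real.dist_eq, Real.dist_eq]
  refine Real.sqrt_le_iff.mpr ⟨by positivity, ?_⟩
  nlinarith [abs_nonneg (z 0 - w 0), abs_nonneg (z 1 - w 1)]

lemma abs_sub_le_dist (z w : EuclideanSpace ℝ (Fin 2)) (i : Fin 2) :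
    |z i - w i| ≤ dist z w := by
  rw [dist_eq_norm, ← Real.norm_eq_abs]
  exact PiLp.norm_apply_le (z - w) i

lemma dist_point_le (hm : 2 ≤ m) (hmn : m < n) (hAsub : ∀ p ∈ A, p.1 < n ∧ p.2 < m) {q : ℕ}
    {p p' : ℕ → A} (h : code n m q p = code n m q p') :
    dist (point n m p) (point n m p') ≤ 2 * ((n : ℝ) ^ q)⁻¹ := by
  obtain ⟨h1, h2⟩ := (code_eq_iff hm hmn).mp h
  have hn : (0 : ℝ) < n := by exact_mod_cast (by omega : 0 < n)
  have e1 := abs_expansion_sub_le (b := n) (by omega) (fun i => (hAsub _ (p i).2).1)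
    (fun i => (hAsub _ (p' i).2).1) h1
  have e2 := abs_expansion_sub_le hm (fun i => (hAsub _ (p i).2).2)
    (fun i => (hAsub _ (p' i).2).2) h2
  have e3 : ((m : ℝ) ^ depth n m q)⁻¹ ≤ ((n : ℝ) ^ q)⁻¹ :=
    inv_anti₀ (by positivity) (by exact_mod_cast pow_le_pow_depth hm n q)
  refine (dist_le_abs_add_abs _ _).trans ?_
  calc _ ≤ ((n : ℝ) ^ q)⁻¹ + ((m : ℝ) ^ depth n m q)⁻¹ := add_le_add e1 e2
    _ ≤ _ := by linarith

/-- The multiplicity constant in the comparison of balls and approximate squares. -/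
def multiplicity (m : ℕ) : ℕ := 7 * (2 * m + 5)

/-- Points in distinct approximate squares need many balls to be covered. -/
lemma card_le_of_cover (hm : 2 ≤ m) (hmn : m < n) (hAsub : ∀ p ∈ A, p.1 < n ∧ p.2 < m) {q : ℕ}
    {W : Type*} [Fintype W] (p : W → ℕ → A)
    (hp : Function.Injective fun w => code n m q (p w))
    (F : Finset (EuclideanSpace ℝ (Fin 2)))
    (hF : ∀ w, point n m (p w) ∈ ⋃ y ∈ F, ball y ((n : ℝ) ^ q)⁻¹) :
    Fintype.card W ≤ multiplicity m * F.card := by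
  have hn : (0 : ℝ) < n := by exact_mod_cast (by omega : 0 < n)
  have hx : ∀ w i, (p w i).1.1 < n := fun w i => (hAsub _ (p w i).2).1
  have hy : ∀ w i, (p w i).1.2 < m := fun w i => (hAsub _ (p w i).2).2
  simp only [mem_iUnion, exists_prop] at hF
  choose c hcF hc using hF
  let f : W → EuclideanSpace ℝ (Fin 2) × ℤ × ℤ := fun w =>
    (c w, (leadingInt n (fun i => (p w i).1.1) q : ℤ) - ⌊(n : ℝ) ^ q * c w 0⌋,
      (leadingInt m (fun i => (p w i).1.2) (depth n m q) : ℤ) -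
        ⌊(m : ℝ) ^ depth n m q * c w 1⌋)
  have hf : Function.Injective f := by
    intro w w' h
    simp only [f, Prod.mk.injEq] at h
    obtain ⟨h1, h2, h3⟩ := h
    rw [h1] at h2 h3
    refine hp ((code_eq_iff hm hmn).mpr ⟨?_, ?_⟩)
    · exact leadingInt_inj (hx w) (hx w') (by omega)
    · exact leadingInt_inj (hy w) (hy w') (by omega)
  have hmem : ∀ w ∈ Finset.univ, f w ∈ F ×ˢ (Finset.Icc (-((1 : ℕ) : ℤ) - 2) ((1 : ℕ) + 2) ×ˢ
      Finset.Icc (-(m : ℤ) - 2) (m + 2)) := by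
    intro w _
    have hd := (mem_ball.mp (hc w)).le
    refine Finset.mem_product.mpr ⟨hcF w, Finset.mem_product.mpr ⟨?_, ?_⟩⟩
    · refine leadingInt_sub_floor_mem (by omega) (hx w) (r := ((n : ℝ) ^ q)⁻¹) ?_
        ((abs_sub_le_dist _ _ 0).trans hd)
      rw [mul_inv_cancel₀ (by positivity)]; simp
    · refine leadingInt_sub_floor_mem hm (hy w) (r := ((n : ℝ) ^ q)⁻¹) ?_
        ((abs_sub_le_dist _ _ 1).trans hd)
      rw [← div_eq_mul_inv, div_le_iff₀ (by positivity)]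
      exact_mod_cast pow_depth_le hm hmn q
  have h := Finset.card_le_card_of_injOn f hmem hf.injOn
  rw [Finset.card_product, Finset.card_product, Int.card_Icc, Int.card_Icc, Finset.card_univ] at h
  refine h.trans_eq ?_
  have e1 : (((1 : ℕ) : ℤ) + 2 + 1 - (-((1 : ℕ) : ℤ) - 2)).toNat = 7 := rfl
  have e2 : ((m : ℤ) + 2 + 1 - (-(m : ℤ) - 2)).toNat = 2 * m + 5 := by omega
  rw [e1, e2, multiplicity, mul_comm]

end Geometry

/-! ### Counting approximate squares -/

section Counting

variable {n m : ℕ} {A : Finset (ℕ × ℕ)}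

/-- An element of `A` in a given non-empty row. -/
noncomputable def rep (j : rowSet A) : A :=
  ⟨(Finset.mem_image.mp j.2).choose, (Finset.mem_image.mp j.2).choose_spec.1⟩

lemma row_rep (j : rowSet A) : row (rep j) = j :=
  Subtype.ext (Finset.mem_image.mp j.2).choose_spec.2

/-- A digit sequence with prescribed approximate square. -/
noncomputable def digitsOf (a₀ : A) {q : ℕ} (w : Code n m A q) (i : ℕ) : A :=
  if h : i < q then w.1 ⟨i, h⟩
  else if h' : i - q < depth n m q - q then rep (w.2 ⟨i - q, h'⟩) else a₀

lemma code_digitsOf (a₀ : A) {q : ℕ} (w : Code n m A q) : code n m q (digitsOf a₀ w) = w := by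
  refine Prod.ext (funext fun i => ?_) (funext fun i => ?_)
  · simp [code, digitsOf]
  · simp [code, digitsOf, row_rep]

lemma card_code (n m : ℕ) (A : Finset (ℕ × ℕ)) (q : ℕ) :
    Fintype.card (Code n m A q) = A.card ^ q * (rowSet A).card ^ (depth n m q - q) := by
  simp [Code]

lemma exists_cover (hm : 2 ≤ m) (hmn : m < n) (hA : A.Nonempty)
    (hAsub : ∀ p ∈ A, p.1 < n ∧ p.2 < m) (q : ℕ) :
    ∃ F : Finset (EuclideanSpace ℝ (Fin 2)), F.card ≤ Fintype.card (Code n m A q) ∧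
      bmCarpet n m A ⊆ ⋃ y ∈ F, ball y (3 * ((n : ℝ) ^ q)⁻¹) := by
  classical
  obtain ⟨a, ha⟩ := hA
  have hn : (0 : ℝ) < n := by exact_mod_cast (by omega : 0 < n)
  refine ⟨Finset.univ.image fun w : Code n m A q => point n m (digitsOf (⟨a, ha⟩ : A) w),
    Finset.card_image_le, ?_⟩
  rw [bmCarpet_eq_range]
  rintro _ ⟨p, rfl⟩
  simp only [mem_iUnion, exists_prop]
  refine ⟨point n m (digitsOf (⟨a, ha⟩ : A) (code n m q p)),
    Finset.mem_image.mpr ⟨code n m q p, Finset.mem_univ _, rfl⟩, ?_⟩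
  have h := dist_point_le hm hmn hAsub (code_digitsOf (⟨a, ha⟩ : A) (code n m q p)).symm
  have : 0 < ((n : ℝ) ^ q)⁻¹ := by positivity
  exact mem_ball.mpr (by linarith)

lemma coveringNumber_le {X : Type*} [PseudoMetricSpace X] {E : Set X} {ε ε' : ℝ} (h : ε' ≤ ε)
    {F : Finset X} (hF : E ⊆ ⋃ y ∈ F, ball y ε') : coveringNumber E ε ≤ F.card :=
  Nat.sInf_le ⟨F, rfl, hF.trans (iUnion₂_mono fun _ _ => ball_subset_ball h)⟩

lemma exists_card_eq_coveringNumber {X : Type*} [PseudoMetricSpace X] {E : Set X} {ε ε' : ℝ}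
    (h : ε' ≤ ε) {F : Finset X} (hF : E ⊆ ⋃ y ∈ F, ball y ε') :
    ∃ G : Finset X, G.card = _root_.coveringNumber E ε ∧ E ⊆ ⋃ y ∈ G, ball y ε :=
  Nat.sInf_mem (s := {N : ℕ | ∃ G : Finset X, G.card = N ∧ E ⊆ ⋃ y ∈ G, ball y ε}) ⟨F.card, F, rfl,
    hF.trans (iUnion₂_mono fun _ _ => ball_subset_ball h)⟩

lemma exists_pow_inv_near (hn : 2 ≤ n) {ε : ℝ} (hε : 0 < ε) (hε1 : ε ≤ 1) :
    ∃ q : ℕ, ((n : ℝ) ^ (q + 1))⁻¹ < ε ∧ ε ≤ ((n : ℝ) ^ q)⁻¹ := by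
  have hn' : (1 : ℝ) < n := by exact_mod_cast hn
  obtain ⟨q, h1, h2⟩ := exists_nat_pow_near_of_lt_one hε hε1 (y := (n : ℝ)⁻¹) (by positivity)
    (inv_lt_one_of_one_lt₀ hn')
  exact ⟨q, by simpa only [inv_pow] using h1, by simpa only [inv_pow] using h2⟩

/-- The value of the Minkowski dimension. -/
noncomputable def minkowskiValue (n m : ℕ) (A : Finset (ℕ × ℕ)) : ℝ :=
  Real.log (rowSet A).card / Real.log m +
    (Real.log A.card - Real.log (rowSet A).card) / Real.log n

lemma card_rowSet_pos (hA : A.Nonempty) : 0 < (rowSet A).card :=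
  Finset.card_pos.mpr (hA.image _)

lemma minkowskiValue_mul_log (hm : 2 ≤ m) (hmn : m < n) :
    minkowskiValue n m A * Real.log n = Real.log (rowSet A).card / kappa n m +
      (Real.log A.card - Real.log (rowSet A).card) := by
  have h1 := log_pos_of_two_le hm
  have h2 := log_pos_of_two_le (b := n) (by omega)
  rw [minkowskiValue, kappa]
  field_simp

lemma minkowskiValue_nonneg (hA : A.Nonempty) : 0 ≤ minkowskiValue n m A := by
  have h0 := card_rowSet_pos hA
  have h1 : Real.log (rowSet A).card ≤ Real.log A.card :=
    Real.log_le_log (by exact_mod_cast h0) (by exact_mod_cast Finset.card_image_le)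
  have h2 : 0 ≤ Real.log (rowSet A).card := Real.log_natCast_nonneg _
  have h3 : 0 ≤ Real.log n := Real.log_natCast_nonneg _
  have h4 : 0 ≤ Real.log m := Real.log_natCast_nonneg _
  exact add_nonneg (div_nonneg h2 h4) (div_nonneg (by linarith) h3)

lemma log_card_code (hm : 2 ≤ m) (hmn : m < n) (hA : A.Nonempty) (q : ℕ) :
    Real.log (Fintype.card (Code n m A q)) = q * Real.log A.card +
      ((depth n m q : ℝ) - q) * Real.log (rowSet A).card := by
  have h0 : ((rowSet A).card : ℝ) ≠ 0 := by exact_mod_cast (card_rowSet_pos hA).ne'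
  have h1 : (A.card : ℝ) ≠ 0 := by exact_mod_cast hA.card_pos.ne'
  rw [card_code, Nat.cast_mul, Nat.cast_pow, Nat.cast_pow, Real.log_mul (by positivity)
    (by positivity), Real.log_pow, Real.log_pow, Nat.cast_sub (le_depth hm hmn q)]

lemma le_log_card_code (hm : 2 ≤ m) (hmn : m < n) (hA : A.Nonempty) (q : ℕ) :
    minkowskiValue n m A * Real.log n * q ≤ Real.log (Fintype.card (Code n m A q)) := by
  have hk := kappa_pos hm hmn
  have h2 : 0 ≤ Real.log (rowSet A).card := Real.log_natCast_nonneg _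
  have h3 : (q : ℝ) / kappa n m ≤ depth n m q := by
    rw [div_le_iff₀ hk]; linarith [le_kappa_mul_depth hm hmn q]
  rw [log_card_code hm hmn hA, minkowskiValue_mul_log hm hmn]
  have h4 := mul_le_mul_of_nonneg_right h3 h2
  have h5 : Real.log (rowSet A).card / kappa n m * q =
    q / kappa n m * Real.log (rowSet A).card := by ring
  linarith

lemma log_card_code_le (hm : 2 ≤ m) (hmn : m < n) (hA : A.Nonempty) (q : ℕ) :
    Real.log (Fintype.card (Code n m A q)) ≤
      Real.log (rowSet A).card + minkowskiValue n m A * Real.log n * q := by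
  have hk := kappa_pos hm hmn
  have h2 : 0 ≤ Real.log (rowSet A).card := Real.log_natCast_nonneg _
  have h3 : depth n m q ≤ (q : ℝ) / kappa n m + 1 := by
    rw [← sub_le_iff_le_add, le_div_iff₀ hk]; linarith [kappa_mul_depth_le hm hmn q]
  rw [log_card_code hm hmn hA, minkowskiValue_mul_log hm hmn]
  have h4 := mul_le_mul_of_nonneg_right h3 h2
  have h5 : Real.log (rowSet A).card / kappa n m * q =
    q / kappa n m * Real.log (rowSet A).card := by ring
  linarith

lemma log_coveringNumber_le (hm : 2 ≤ m) (hmn : m < n) (hA : A.Nonempty)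
    (hAsub : ∀ p ∈ A, p.1 < n ∧ p.2 < m) {ε : ℝ} (hε : 0 < ε) (hε1 : ε ≤ 1) :
    Real.log (coveringNumber (bmCarpet n m A) ε) ≤
      Real.log (rowSet A).card + minkowskiValue n m A * (Real.log n + Real.log 3) +
        minkowskiValue n m A * Real.log (1 / ε) := by
  have hn : (0 : ℝ) < n := by exact_mod_cast (by omega : 0 < n)
  obtain ⟨q, h1, h2⟩ := exists_pow_inv_near (n := n) (by omega) (ε := ε / 3) (by positivity)
    (by linarith)
  obtain ⟨F, hF, hc⟩ := exists_cover hm hmn hA hAsub (q + 1)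
  have h3 := (coveringNumber_le (ε := ε) (by linarith) hc).trans hF
  have h4 : Real.log (coveringNumber (bmCarpet n m A) ε) ≤
      Real.log (Fintype.card (Code n m A (q + 1))) := by
    rcases (coveringNumber (bmCarpet n m A) ε).eq_zero_or_pos with h | h
    · rw [h, Nat.cast_zero, Real.log_zero]
      exact Real.log_natCast_nonneg _
    · exact Real.log_le_log (by exact_mod_cast h) (by exact_mod_cast h3)
  have h5 := log_card_code_le hm hmn hA (q + 1)
  have h6 : q * Real.log n ≤ Real.log 3 + Real.log (1 / ε) := by
    have := Real.log_le_log (by positivity) h2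
    rw [Real.log_inv, Real.log_pow, Real.log_div hε.ne' (by norm_num)] at this
    rw [one_div, Real.log_inv]
    linarith
  have h7 := mul_le_mul_of_nonneg_left h6 (minkowskiValue_nonneg (n := n) (m := m) hA)
  push_cast at h5
  nlinarith

lemma le_log_coveringNumber (hm : 2 ≤ m) (hmn : m < n) (hA : A.Nonempty)
    (hAsub : ∀ p ∈ A, p.1 < n ∧ p.2 < m) {ε : ℝ} (hε : 0 < ε) (hε1 : ε ≤ 1) :
    -(Real.log (multiplicity m) + minkowskiValue n m A * Real.log n) +
        minkowskiValue n m A * Real.log (1 / ε) ≤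
      Real.log (coveringNumber (bmCarpet n m A) ε) := by
  have hn : (0 : ℝ) < n := by exact_mod_cast (by omega : 0 < n)
  obtain ⟨a, ha⟩ := id hA
  obtain ⟨q, h1, h2⟩ := exists_pow_inv_near (n := n) (by omega) hε hε1
  obtain ⟨q', h1', -⟩ := exists_pow_inv_near (n := n) (by omega) (ε := ε / 3) (by positivity)
    (by linarith)
  obtain ⟨F', -, hc'⟩ := exists_cover hm hmn hA hAsub (q' + 1)
  obtain ⟨F, hF, hc⟩ := exists_card_eq_coveringNumber (ε := ε) (by linarith) hc'
  have h3 := card_le_of_cover hm hmn hAsub (q := q) (digitsOf (⟨a, ha⟩ : A))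
    (fun w w' h => by
      have h' : code n m q (digitsOf _ w) = code n m q (digitsOf _ w') := h
      rwa [code_digitsOf, code_digitsOf] at h') F (fun w => by
      have hw : point n m (digitsOf (⟨a, ha⟩ : A) w) ∈ bmCarpet n m A := by
        rw [bmCarpet_eq_range]; exact mem_range_self _
      exact iUnion₂_mono (fun _ _ => ball_subset_ball h2) (hc hw))
  rw [hF] at h3
  have hpos : 0 < Fintype.card (Code n m A q) := by
    rw [card_code]
    have := hA.card_pos
    have := card_rowSet_pos hA
    positivity
  have hN : coveringNumber (bmCarpet n m A) ε ≠ 0 := by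
    intro h; rw [h] at h3; omega
  have h4 := Real.log_le_log (by exact_mod_cast hpos)
    (show (Fintype.card (Code n m A q) : ℝ) ≤ multiplicity m *
      coveringNumber (bmCarpet n m A) ε by exact_mod_cast h3)
  rw [Real.log_mul (by exact_mod_cast (by simp [multiplicity] : multiplicity m ≠ 0))
    (by exact_mod_cast hN)] at h4
  have h5 := le_log_card_code hm hmn hA q
  have h6 : Real.log (1 / ε) ≤ (q + 1) * Real.log n := by
    have := Real.log_le_log (by positivity) h1.le
    rw [Real.log_inv, Real.log_pow] at this
    rw [one_div, Real.log_inv]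
    push_cast at this
    linarith
  have h7 := mul_le_mul_of_nonneg_left h6 (minkowskiValue_nonneg (n := n) (m := m) hA)
  nlinarith

theorem upperMinkowskiDim_eq (hm : 2 ≤ m) (hmn : m < n) (hA : A.Nonempty)
    (hAsub : ∀ p ∈ A, p.1 < n ∧ p.2 < m) :
    upperMinkowskiDim (bmCarpet n m A) = minkowskiValue n m A := by
  have hL : Tendsto (fun ε : ℝ => Real.log (1 / ε)) (nhdsWithin 0 (Ioi 0)) atTop := by
    simp only [one_div]
    exact Real.tendsto_log_atTop.comp tendsto_inv_nhdsGT_zero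
  have hlim : ∀ c : ℝ, Tendsto (fun ε : ℝ => c / Real.log (1 / ε) + minkowskiValue n m A)
      (nhdsWithin 0 (Ioi 0)) (nhds (minkowskiValue n m A)) := fun c => by
    simpa using (hL.const_div_atTop c).add_const (minkowskiValue n m A)
  have hev : ∀ᶠ ε : ℝ in nhdsWithin 0 (Ioi 0), 0 < ε ∧ ε < 1 :=
    Ioo_mem_nhdsGT one_pos
  refine Tendsto.limsup_eq (tendsto_of_tendsto_of_tendsto_of_le_of_le'
    (hlim (-(Real.log (multiplicity m) + minkowskiValue n m A * Real.log n)))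
    (hlim (Real.log (rowSet A).card + minkowskiValue n m A * (Real.log n + Real.log 3))) ?_ ?_)
  · filter_upwards [hev] with ε hε
    have hpos : 0 < Real.log (1 / ε) := Real.log_pos (by rw [lt_div_iff₀ hε.1]; linarith [hε.2])
    rw [le_div_iff₀ hpos, add_mul, div_mul_cancel₀ _ hpos.ne']
    exact le_log_coveringNumber hm hmn hA hAsub hε.1 hε.2.le
  · filter_upwards [hev] with ε hε
    have hpos : 0 < Real.log (1 / ε) := Real.log_pos (by rw [lt_div_iff₀ hε.1]; linarith [hε.2])
    rw [div_le_iff₀ hpos, add_mul, div_mul_cancel₀ _ hpos.ne']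
    exact log_coveringNumber_le hm hmn hA hAsub hε.1 hε.2.le

end Counting

/-! ### Assouad dimension -/

/-- Balls in the plane are covered by quadratically many smaller balls. -/
lemma exists_cover_ball (x : EuclideanSpace ℝ (Fin 2)) {r R : ℝ} (hr : 0 < r) (hrR : r ≤ R) :
    ∃ F : Finset (EuclideanSpace ℝ (Fin 2)), (F.card : ℝ) ≤ 121 * (R / r) ^ (2 : ℝ) ∧
      ball x R ⊆ ⋃ y ∈ F, ball y r := by
  classical
  have hR : 1 ≤ R / r := (one_le_div hr).mpr hrR
  let k : ℕ := ⌈3 * (R / r)⌉₊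
  have hk1 : 3 * (R / r) ≤ k := Nat.le_ceil _
  have hk2 : (k : ℝ) < 3 * (R / r) + 1 := Nat.ceil_lt_add_one (by positivity)
  let c : ℤ × ℤ → EuclideanSpace ℝ (Fin 2) := fun a =>
    !₂[x 0 + r / 3 * a.1, x 1 + r / 3 * a.2]
  let I : Finset ℤ := Finset.Icc (-(k : ℤ) - 1) k
  refine ⟨(I ×ˢ I).image c, ?_, fun z hz => ?_⟩
  · have h1 : ((I ×ˢ I).image c).card ≤ (2 * k + 2) * (2 * k + 2) := by
      refine Finset.card_image_le.trans ?_
      rw [Finset.card_product, Int.card_Icc]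
      have : ((k : ℤ) + 1 - (-(k : ℤ) - 1)).toNat = 2 * k + 2 := by omega
      rw [this]
    have h2 : (((I ×ˢ I).image c).card : ℝ) ≤ (2 * k + 2) * (2 * k + 2) := by exact_mod_cast h1
    refine h2.trans ?_
    rw [Real.rpow_two]
    have h3 : (2 * (k : ℝ) + 2) ≤ 10 * (R / r) + 1 * (R / r) := by linarith
    have h4 : (0 : ℝ) ≤ 2 * k + 2 := by positivity
    nlinarith
  · simp only [mem_iUnion, exists_prop]
    have hd := (mem_ball.mp hz).le
    let a : Fin 2 → ℤ := fun i => ⌊(z i - x i) / (r / 3)⌋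
    have hnear : ∀ i, |z i - (x i + r / 3 * a i)| ≤ r / 3 := fun i => by
      have h1 := Int.floor_le ((z i - x i) / (r / 3))
      have h2 := Int.lt_floor_add_one ((z i - x i) / (r / 3))
      rw [le_div_iff₀ (by positivity)] at h1
      rw [div_lt_iff₀ (by positivity)] at h2
      rw [abs_le]
      constructor <;> simp only [a] <;> nlinarith
    have hmem : ∀ i, a i ∈ I := fun i => by
      have h0 := abs_le.mp ((abs_sub_le_dist z x i).trans hd)
      have e : R = R / r * r := by field_simp
      have h3 : (z i - x i) / (r / 3) ≤ k := by
        rw [div_le_iff₀ (by positivity)]; nlinarith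
      have h4 : -(k : ℝ) ≤ (z i - x i) / (r / 3) := by
        rw [le_div_iff₀ (by positivity)]; nlinarith
      refine Finset.mem_Icc.mpr ⟨?_, ?_⟩
      · have : -(k : ℤ) ≤ a i := Int.le_floor.mpr (by push_cast; exact h4)
        omega
      · have : (a i : ℝ) ≤ k := (Int.floor_le ((z i - x i) / (r / 3))).trans h3
        exact_mod_cast this
    refine ⟨c (a 0, a 1), Finset.mem_image_of_mem _ (Finset.mem_product.mpr ⟨hmem 0, hmem 1⟩), ?_⟩
    refine mem_ball.mpr ((dist_le_abs_add_abs _ _).trans_lt ?_)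
    have h0 : |z 0 - c (a 0, a 1) 0| ≤ r / 3 := hnear 0
    have h1 : |z 1 - c (a 0, a 1) 1| ≤ r / 3 := hnear 1
    linarith

section Assouad

variable {n m : ℕ} {A : Finset (ℕ × ℕ)}

lemma exists_lt_depth_sub (hm : 2 ≤ m) (hmn : m < n) (B : ℝ) :
    ∃ q : ℕ, B < ((depth n m q - q : ℕ) : ℝ) := by
  have hk := kappa_pos hm hmn
  have hk1 := kappa_lt_one hm hmn
  have hc : 0 < (kappa n m)⁻¹ - 1 := by
    have := (one_lt_inv₀ hk).mpr hk1
    linarith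
  obtain ⟨q, hq⟩ := exists_nat_gt (B / ((kappa n m)⁻¹ - 1))
  refine ⟨q, ?_⟩
  rw [Nat.cast_sub (le_depth hm hmn q)]
  rw [div_lt_iff₀ hc] at hq
  have h1 : (q : ℝ) * (kappa n m)⁻¹ ≤ depth n m q := by
    rw [← div_eq_mul_inv, div_le_iff₀ hk]; linarith [le_kappa_mul_depth hm hmn q]
  linarith

/-- Digit sequences running through a thin family of approximate squares whose rows in the
middle range of digits are all equal to `j`. -/
noncomputable def thinDigits (n m : ℕ) (j : rowSet A) (q : ℕ)
    (w : (Fin (depth n m q - q) → {a : A // row a = j}) ×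
      (Fin (depth n m (depth n m q) - depth n m q) → rowSet A)) (i : ℕ) : A :=
  if i < q then rep j
  else if h : i - q < depth n m q - q then (w.1 ⟨i - q, h⟩).1
  else if h : i - depth n m q < depth n m (depth n m q) - depth n m q then
    rep (w.2 ⟨i - depth n m q, h⟩)
  else rep j

lemma code_thinDigits_eq (hm : 2 ≤ m) (hmn : m < n) (j : rowSet A) (q : ℕ) (w w') :
    code n m q (thinDigits n m j q w) = code n m q (thinDigits n m j q w') := by
  have hrow : ∀ w, ∀ i < depth n m q, row (thinDigits n m j q w i) = j := by
    intro w i hi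
    by_cases h : i < q
    · simp [thinDigits, h, row_rep]
    · have h' : i - q < depth n m q - q := by omega
      simp only [thinDigits, h, h', if_false, dif_pos]
      exact (w.1 _).2
  refine (code_eq_iff hm hmn).mpr ⟨fun i hi => ?_, fun i hi => ?_⟩
  · simp [thinDigits, hi]
  · exact congrArg Subtype.val ((hrow w i hi).trans (hrow w' i hi).symm)

lemma code_thinDigits_injective (hm : 2 ≤ m) (hmn : m < n) (j : rowSet A) (q : ℕ) :
    Function.Injective fun w => code n m (depth n m q) (thinDigits n m j q w) := by
  have hq := le_depth hm hmn q
  intro w w' h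
  refine Prod.ext (funext fun i => Subtype.ext ?_) (funext fun i => ?_)
  · have := congrFun (congrArg Prod.fst h) ⟨q + i, by omega⟩
    simpa [code, thinDigits] using this
  · have := congrFun (congrArg Prod.snd h) i
    have h1 : ¬ depth n m q + i < q := by omega
    have h2 : ¬ depth n m q + i - q < depth n m q - q := by omega
    simpa [code, thinDigits, h1, h2, row_rep] using this

lemma card_row_fiber (j : rowSet A) : Fintype.card {a : A // row a = j} = rowCount A j := by
  rw [Fintype.card_subtype, rowCount, ← Finset.card_map (Function.Embedding.subtype _)]
  congr 1
  ext a
  constructor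
  · simp only [Finset.mem_map, Finset.mem_filter, Finset.mem_univ, true_and]
    rintro ⟨b, hb, rfl⟩
    exact ⟨b.2, congrArg Subtype.val hb⟩
  · intro h
    obtain ⟨h1, h2⟩ := Finset.mem_filter.mp h
    exact Finset.mem_map.mpr ⟨⟨a, h1⟩, by simpa using Subtype.ext h2, rfl⟩

lemma rowCount_pos (j : rowSet A) : 0 < rowCount A j := by
  rw [← card_row_fiber, Fintype.card_pos_iff]
  exact ⟨⟨rep j, row_rep j⟩⟩

theorem le_assouadDim (hm : 2 ≤ m) (hmn : m < n) (hAsub : ∀ p ∈ A, p.1 < n ∧ p.2 < m)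
    (j : rowSet A) :
    Real.log (rowSet A).card / Real.log m + Real.log (rowCount A j) / Real.log n ≤
      assouadDim (bmCarpet n m A) := by
  refine le_csInf ⟨2, by norm_num, 121, by norm_num, fun x _ r R hr hrR => ?_⟩ ?_
  · obtain ⟨F, hF, hc⟩ := exists_cover_ball x hr hrR
    exact ⟨F, hF, inter_subset_right.trans hc⟩
  rintro α ⟨hα, C, hC, hcov⟩
  have hn : (1 : ℝ) < n := by exact_mod_cast (by omega : 1 < n)
  have hn0 : (0 : ℝ) < n := by linarith
  have hk := kappa_pos hm hmn
  have hs : 0 < (rowSet A).card := Finset.card_pos.mpr ⟨j, j.2⟩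
  have hls : 0 ≤ Real.log (rowSet A).card := Real.log_natCast_nonneg _
  set D := Real.log (rowSet A).card / Real.log m + Real.log (rowCount A j) / Real.log n with hD
  have hDlog : D * Real.log n = Real.log (rowSet A).card / kappa n m +
      Real.log (rowCount A j) := by
    have h1 := log_pos_of_two_le hm
    have h2 := log_pos_of_two_le (b := n) (by omega)
    rw [hD, kappa]
    field_simp
  set c := Real.log (multiplicity m * C) + α * Real.log 3 + Real.log (rowSet A).card with hc
  have hbound : ∀ q : ℕ,
      (D - α) * Real.log n * ((depth n m q - q : ℕ) : ℝ) ≤ c := by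
    intro q
    have hq := le_depth hm hmn q
    set q₂ := depth n m q with hq₂
    have hq2 := le_depth hm hmn q₂
    have w₀ : (Fin (q₂ - q) → {a : A // row a = j}) × (Fin (depth n m q₂ - q₂) → rowSet A) :=
      (fun _ => ⟨rep j, row_rep j⟩, fun _ => j)
    have hmem : ∀ w, point n m (thinDigits n m j q w) ∈ bmCarpet n m A := fun w => by
      rw [bmCarpet_eq_range]; exact mem_range_self _
    have hle : ((n : ℝ) ^ q₂)⁻¹ ≤ 3 * ((n : ℝ) ^ q)⁻¹ := by
      have h1 : ((n : ℝ) ^ q₂)⁻¹ ≤ ((n : ℝ) ^ q)⁻¹ :=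
        inv_anti₀ (by positivity) (pow_le_pow_right₀ hn.le hq)
      have h2 : 0 < ((n : ℝ) ^ q)⁻¹ := by positivity
      linarith
    obtain ⟨F, hF, hFc⟩ := hcov _ (hmem w₀) _ _ (by positivity) hle
    have hcard := card_le_of_cover hm hmn hAsub (thinDigits n m j q)
      (code_thinDigits_injective hm hmn j q) F fun w => by
        refine hFc ⟨hmem w, mem_ball.mpr ?_⟩
        have h1 := dist_point_le hm hmn hAsub (code_thinDigits_eq hm hmn j q w w₀)
        have h2 : 0 < ((n : ℝ) ^ q)⁻¹ := by positivity
        linarith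
    have hW : Fintype.card ((Fin (q₂ - q) → {a : A // row a = j}) ×
        (Fin (depth n m q₂ - q₂) → rowSet A)) =
        rowCount A j ^ (q₂ - q) * (rowSet A).card ^ (depth n m q₂ - q₂) := by
      rw [Fintype.card_prod, Fintype.card_fun, Fintype.card_fun, card_row_fiber]
      simp
    rw [hW] at hcard
    have hratio : 3 * ((n : ℝ) ^ q)⁻¹ / ((n : ℝ) ^ q₂)⁻¹ = 3 * (n : ℝ) ^ (q₂ - q) := by
      rw [div_inv_eq_mul, pow_sub₀ _ hn0.ne' hq]; ring
    rw [hratio] at hF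
    have hreal : (rowCount A j : ℝ) ^ (q₂ - q) * ((rowSet A).card : ℝ) ^ (depth n m q₂ - q₂) ≤
        multiplicity m * C * (3 * (n : ℝ) ^ (q₂ - q)) ^ α := by
      have h1 : (rowCount A j : ℝ) ^ (q₂ - q) * ((rowSet A).card : ℝ) ^ (depth n m q₂ - q₂) ≤
        multiplicity m * F.card := by exact_mod_cast hcard
      refine h1.trans ?_
      rw [mul_assoc]
      gcongr
    have ht' : (0 : ℝ) < rowCount A j := by exact_mod_cast rowCount_pos j
    have hs' : (0 : ℝ) < (rowSet A).card := by exact_mod_cast hs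
    have hmul : (0 : ℝ) < multiplicity m := by exact_mod_cast (by simp [multiplicity] : 0 < multiplicity m)
    have hlog := Real.log_le_log (by positivity) hreal
    rw [Real.log_mul (by positivity) (by positivity), Real.log_pow, Real.log_pow,
      Real.log_mul (by positivity) (by positivity), Real.log_rpow (by positivity),
      Real.log_mul (x := 3) (by norm_num) (by positivity), Real.log_pow] at hlog
    have hT : ((q₂ - q : ℕ) : ℝ) / kappa n m ≤ ((depth n m q₂ - q₂ : ℕ) : ℝ) + 1 := by
      rw [div_le_iff₀ hk, Nat.cast_sub hq, Nat.cast_sub hq2]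
      have h1 := le_kappa_mul_depth hm hmn q₂
      have h2 := kappa_mul_depth_le hm hmn q
      rw [← hq₂] at h2
      linarith
    have hT' := mul_le_mul_of_nonneg_right hT hls
    have e : (D - α) * Real.log n * ((q₂ - q : ℕ) : ℝ) =
        ((q₂ - q : ℕ) : ℝ) / kappa n m * Real.log (rowSet A).card +
        ((q₂ - q : ℕ) : ℝ) * Real.log (rowCount A j) -
        α * (((q₂ - q : ℕ) : ℝ) * Real.log n) := by
      rw [sub_mul, hDlog]; ring
    rw [e, hc]
    linarith
  by_contra! hlt
  have hpos : 0 < (D - α) * Real.log n :=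
    mul_pos (by linarith) (log_pos_of_two_le (by omega))
  obtain ⟨q, hq⟩ := exists_lt_depth_sub hm hmn (c / ((D - α) * Real.log n))
  rw [div_lt_iff₀ hpos] at hq
  linarith [hbound q]

end Assouad

/-! ### Hausdorff dimension -/

/-- Along infinitely many scales the average of a non-negative sequence does not drop. -/
lemma exists_average_not_drop {n m : ℕ} (hm : 2 ≤ m) (hmn : m < n) {g : ℕ → ℝ}
    (hg : ∀ i, 0 ≤ g i) {ε : ℝ} (hε : 0 < ε) (Q : ℕ) :
    ∃ q, Q ≤ q ∧ 0 ≤ kappa n m * ∑ i ∈ Finset.range (depth n m q), g i -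
      ∑ i ∈ Finset.range q, g i + ε * q := by
  by_contra! hcon
  let S : ℕ → ℝ := fun k => ∑ i ∈ Finset.range k, g i
  have hS : ∀ k, 0 ≤ S k := fun k => Finset.sum_nonneg fun i _ => hg i
  let r : ℕ → ℕ := fun k => (depth n m)^[k] (Q + 1)
  have hr : ∀ k, r (k + 1) = depth n m (r k) := fun k => Function.iterate_succ_apply' _ _ _
  have hrQ : ∀ k, Q + 1 ≤ r k := by
    intro k
    induction k with
    | zero => exact le_rfl
    | succ k ih => rw [hr]; exact ih.trans (le_depth hm hmn _)
  have hdrop : ∀ k : ℕ, S (r k) / r k ≤ S (r 0) / r 0 - k * ε := by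
    intro k
    induction k with
    | zero => simp
    | succ k ih =>
      have h1 := hcon (r k) (by linarith [hrQ k])
      rw [← hr] at h1
      have hpos : (0 : ℝ) < r k := by exact_mod_cast (Nat.succ_pos Q).trans_le (hrQ k)
      have hpos' : (0 : ℝ) < r (k + 1) := by exact_mod_cast (Nat.succ_pos Q).trans_le (hrQ (k + 1))
      have h2 := le_kappa_mul_depth hm hmn (r k)
      rw [← hr] at h2
      have h3 : S (r (k + 1)) / r (k + 1) * r k ≤ kappa n m * S (r (k + 1)) := by
        rw [div_mul_eq_mul_div, div_le_iff₀ hpos']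
        nlinarith [hS (r (k + 1))]
      have h4 : S (r (k + 1)) / r (k + 1) ≤ S (r k) / r k - ε := by
        rw [← mul_le_mul_iff_left₀ hpos, sub_mul, div_mul_cancel₀ _ hpos.ne']
        simp only [S] at h3 ⊢
        linarith
      push_cast
      linarith
  obtain ⟨k, hk⟩ := exists_nat_gt (S (r 0) / r 0 / ε)
  rw [div_lt_iff₀ hε] at hk
  have : 0 ≤ S (r k) / r k := div_nonneg (hS _) (Nat.cast_nonneg _)
  linarith [hdrop k]

section Hausdorff

variable {n m : ℕ} {A : Finset (ℕ × ℕ)}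

/-- The logarithm of the number of elements of a row. -/
noncomputable def logCount (j : rowSet A) : ℝ := Real.log (rowCount A j)

lemma logCount_nonneg (j : rowSet A) : 0 ≤ logCount j := Real.log_natCast_nonneg _

lemma exp_logCount (j : rowSet A) : Real.exp (logCount j) = rowCount A j :=
  Real.exp_log (by exact_mod_cast rowCount_pos j)

/-- The sum `∑ t_j ^ κ` over the non-empty rows. -/
noncomputable def rowPowerSum (n m : ℕ) (A : Finset (ℕ × ℕ)) : ℝ :=
  ∑ j : rowSet A, Real.exp (kappa n m * logCount j)

lemma sum_row_eq (f : rowSet A → ℝ) :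
    ∑ a : A, f (row a) = ∑ j : rowSet A, (rowCount A j : ℝ) * f j := by
  rw [← Finset.sum_fiberwise Finset.univ row]
  refine Finset.sum_congr rfl fun j _ => ?_
  rw [Finset.sum_congr rfl (g := fun _ => f j) fun a ha => by rw [(Finset.mem_filter.mp ha).2],
    Finset.sum_const, nsmul_eq_mul, ← card_row_fiber, Fintype.card_subtype]

lemma sum_exp_eq_rowPowerSum :
    ∑ a : A, Real.exp ((kappa n m - 1) * logCount (row a)) = rowPowerSum n m A := by
  rw [sum_row_eq fun j => Real.exp ((kappa n m - 1) * logCount j), rowPowerSum]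
  refine Finset.sum_congr rfl fun j _ => ?_
  rw [← exp_logCount, ← Real.exp_add]
  congr 1
  ring

lemma one_le_rowPowerSum (hm : 2 ≤ m) (hmn : m < n) (hA : A.Nonempty) :
    1 ≤ rowPowerSum n m A := by
  obtain ⟨a, ha⟩ := hA
  have h1 : Real.exp (kappa n m * logCount (row (⟨a, ha⟩ : A))) ≤ rowPowerSum n m A :=
    Finset.single_le_sum (f := fun j : rowSet A => Real.exp (kappa n m * logCount j))
      (fun j _ => (Real.exp_pos _).le) (Finset.mem_univ _)
  exact (Real.one_le_exp (mul_nonneg (kappa_pos hm hmn).le (logCount_nonneg _))).trans h1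

/-- The exponential weight of an approximate square. -/
noncomputable def weight {q : ℕ} (ε : ℝ) (w : Code n m A q) : ℝ :=
  Real.exp (ε * q) * ((∏ i, Real.exp ((kappa n m - 1) * logCount (row (w.1 i)))) *
    ∏ i, Real.exp (kappa n m * logCount (w.2 i)))

lemma weight_nonneg {q : ℕ} (ε : ℝ) (w : Code n m A q) : 0 ≤ weight ε w := by
  unfold weight; positivity

lemma sum_weight (hm : 2 ≤ m) (hmn : m < n) (q : ℕ) (ε : ℝ) :
    ∑ w : Code n m A q, weight ε w = Real.exp (ε * q) * rowPowerSum n m A ^ depth n m q := by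
  simp only [weight]
  rw [← Finset.mul_sum, Fintype.sum_prod_type]
  simp only [← Finset.mul_sum]
  rw [← Finset.sum_mul,
    ← Fintype.sum_pow (fun a : A => Real.exp ((kappa n m - 1) * logCount (row a))),
    ← Fintype.sum_pow (fun j : rowSet A => Real.exp (kappa n m * logCount j)),
    sum_exp_eq_rowPowerSum, ← rowPowerSum, ← pow_add, Nat.add_sub_cancel' (le_depth hm hmn q)]

lemma exists_one_le_weight (hm : 2 ≤ m) (hmn : m < n) {ε : ℝ} (hε : 0 < ε) (p : ℕ → A) (Q : ℕ) :
    ∃ q, Q ≤ q ∧ 1 ≤ weight ε (code n m q p) := by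
  obtain ⟨q, hQ, hq⟩ := exists_average_not_drop hm hmn (g := fun i => logCount (row (p i)))
    (fun i => logCount_nonneg _) hε Q
  refine ⟨q, hQ, ?_⟩
  rw [weight, ← Real.exp_sum, ← Real.exp_sum, ← Real.exp_add, ← Real.exp_add, ← Finset.mul_sum,
    ← Finset.mul_sum]
  refine Real.one_le_exp (hq.trans_eq ?_)
  have h1 := Finset.sum_range_add (fun i => logCount (row (p i))) q (depth n m q - q)
  rw [Nat.add_sub_cancel' (le_depth hm hmn q)] at h1
  rw [h1, Finset.sum_range, Finset.sum_range]
  simp only [code]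
  ring

lemma sum_weight_mul_le (hm : 2 ≤ m) (hmn : m < n) (hA : A.Nonempty) {d ε : ℝ}
    (h : 2 * ε ≤ d * Real.log n - Real.log (rowPowerSum n m A) / kappa n m) (q : ℕ) :
    ∑ w : Code n m A q, weight ε w * (2 * ((n : ℝ) ^ q)⁻¹) ^ d ≤
      Real.exp (Real.log (rowPowerSum n m A) + d * Real.log 2) * Real.exp (-ε) ^ q := by
  have hn : (0 : ℝ) < n := by exact_mod_cast (by omega : 0 < n)
  have hk := kappa_pos hm hmn
  have hZ := one_le_rowPowerSum (n := n) (m := m) hm hmn hA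
  have hlZ := Real.log_nonneg hZ
  have hK : depth n m q ≤ (q : ℝ) / kappa n m + 1 := by
    rw [← sub_le_iff_le_add, le_div_iff₀ hk]; linarith [kappa_mul_depth_le hm hmn q]
  have e1 : rowPowerSum n m A ^ depth n m q =
      Real.exp (depth n m q * Real.log (rowPowerSum n m A)) := by
    rw [← Real.log_pow, Real.exp_log (by positivity)]
  have e2 : (2 * ((n : ℝ) ^ q)⁻¹) ^ d = Real.exp (d * (Real.log 2 - q * Real.log n)) := by
    rw [Real.rpow_def_of_pos (by positivity), Real.log_mul (by norm_num) (by positivity),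
      Real.log_inv, Real.log_pow]
    congr 1
    ring
  rw [← Finset.sum_mul, sum_weight hm hmn, e1, e2, ← Real.exp_add, ← Real.exp_add,
    ← Real.exp_nat_mul, ← Real.exp_add]
  refine Real.exp_le_exp.mpr ?_
  have h1 := mul_le_mul_of_nonneg_right hK hlZ
  have h2 := mul_le_mul_of_nonneg_right h (Nat.cast_nonneg (α := ℝ) q)
  have h3 : Real.log (rowPowerSum n m A) / kappa n m * q =
    q / kappa n m * Real.log (rowPowerSum n m A) := by ring
  linarith

open MeasureTheory in
theorem hausdorffMeasure_ne_top (hm : 2 ≤ m) (hmn : m < n) (hA : A.Nonempty)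
    (hAsub : ∀ p ∈ A, p.1 < n ∧ p.2 < m) {d : ℝ}
    (hd : Real.log (rowPowerSum n m A) / kappa n m < d * Real.log n) :
    μH[d] (bmCarpet n m A) ≠ ⊤ := by
  have hn : (1 : ℝ) < n := by exact_mod_cast (by omega : 1 < n)
  have hn0 : (0 : ℝ) < n := by linarith
  have hd0 : 0 < d := by
    have h1 := div_nonneg (Real.log_nonneg (one_le_rowPowerSum (n := n) hm hmn hA))
      (kappa_pos hm hmn).le
    exact pos_of_mul_pos_left (h1.trans_lt hd) (Real.log_natCast_nonneg n)
  obtain ⟨ε, hε, hε2⟩ : ∃ ε : ℝ, 0 < ε ∧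
      2 * ε ≤ d * Real.log n - Real.log (rowPowerSum n m A) / kappa n m :=
    ⟨(d * Real.log n - Real.log (rowPowerSum n m A) / kappa n m) / 2, by linarith, by linarith⟩
  let U : ∀ Q : ℕ, (Σ q, Code n m A q) → Set (EuclideanSpace ℝ (Fin 2)) := fun Q w =>
    {z | Q ≤ w.1 ∧ 1 ≤ weight ε w.2 ∧ ∃ p, code n m w.1 p = w.2 ∧ point n m p = z}
  have hdiam : ∀ Q w, ediam (U Q w) ≤ ENNReal.ofReal (2 * ((n : ℝ) ^ w.1)⁻¹) := by
    refine fun Q w => ediam_le_of_forall_dist_le ?_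
    rintro _ ⟨-, -, p, hp, rfl⟩ _ ⟨-, -, p', hp', rfl⟩
    exact dist_point_le hm hmn hAsub (hp.trans hp'.symm)
  have hempty : ∀ Q w, ¬ (Q ≤ w.1 ∧ 1 ≤ weight ε w.2) → ediam (U Q w) = 0 := by
    intro Q w h
    have : U Q w = ∅ := eq_empty_of_forall_notMem fun z hz => h ⟨hz.1, hz.2.1⟩
    rw [this, ediam_empty]
  have hsum : Summable fun q : ℕ =>
      Real.exp (Real.log (rowPowerSum n m A) + d * Real.log 2) * Real.exp (-ε) ^ q :=
    (summable_geometric_of_lt_one (Real.exp_pos _).le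
      (Real.exp_lt_one_iff.mpr (by linarith))).mul_left _
  refine ne_top_of_le_ne_top hsum.tsum_ofReal_ne_top ?_
  refine (Measure.hausdorffMeasure_le_liminf_tsum d (bmCarpet n m A) (l := atTop)
    (fun Q : ℕ => ENNReal.ofReal (2 * ((n : ℝ) ^ Q)⁻¹)) ?_ U ?_ ?_).trans ?_
  · have h1 : Tendsto (fun Q : ℕ => 2 * ((n : ℝ) ^ Q)⁻¹) atTop (nhds 0) := by
      simpa using (tendsto_inv_atTop_zero.comp (tendsto_pow_atTop_atTop_of_one_lt hn)).const_mul 2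
    simpa using ENNReal.tendsto_ofReal h1
  · refine Eventually.of_forall fun Q w => ?_
    by_cases hw : Q ≤ w.1 ∧ 1 ≤ weight ε w.2
    · refine (hdiam Q w).trans (ENNReal.ofReal_le_ofReal ?_)
      have := inv_anti₀ (by positivity) (pow_le_pow_right₀ hn.le hw.1)
      linarith
    · rw [hempty Q w hw]; exact zero_le
  · refine Eventually.of_forall fun Q => ?_
    rw [bmCarpet_eq_range]
    rintro _ ⟨p, rfl⟩
    obtain ⟨q, hQ, hq⟩ := exists_one_le_weight hm hmn hε p Q
    exact mem_iUnion.mpr ⟨⟨q, code n m q p⟩, hQ, hq, p, rfl, rfl⟩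
  · refine liminf_le_of_le (by isBoundedDefault) fun b hb => ?_
    obtain ⟨Q, hQ⟩ := hb.exists
    refine hQ.trans ?_
    rw [ENNReal.tsum_sigma']
    refine ENNReal.tsum_le_tsum fun q => ?_
    rw [tsum_fintype]
    refine le_trans ?_ (ENNReal.ofReal_le_ofReal (sum_weight_mul_le hm hmn hA hε2 q))
    rw [ENNReal.ofReal_sum_of_nonneg fun w _ => mul_nonneg (weight_nonneg ε w) (by positivity)]
    refine Finset.sum_le_sum fun w _ => ?_
    by_cases hw : Q ≤ q ∧ 1 ≤ weight ε w
    · calc ediam (U Q ⟨q, w⟩) ^ d ≤ ENNReal.ofReal (2 * ((n : ℝ) ^ q)⁻¹) ^ d :=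
            ENNReal.rpow_le_rpow (hdiam Q ⟨q, w⟩) hd0.le
        _ = ENNReal.ofReal ((2 * ((n : ℝ) ^ q)⁻¹) ^ d) :=
            ENNReal.ofReal_rpow_of_pos (by positivity)
        _ ≤ _ := ENNReal.ofReal_le_ofReal (le_mul_of_one_le_left (by positivity) hw.2)
    · rw [hempty Q ⟨q, w⟩ hw, ENNReal.zero_rpow_of_pos hd0]
      exact zero_le

lemma sum_rowCount : ∑ j : rowSet A, (rowCount A j : ℝ) = A.card := by
  have := sum_row_eq (A := A) fun _ => 1
  simpa using this.symm

lemma log_rowPowerSum_div_lt (hm : 2 ≤ m) (hmn : m < n) (hA : A.Nonempty) {j j' : rowSet A}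
    (hjj' : rowCount A j ≠ rowCount A j') :
    Real.log (rowPowerSum n m A) / kappa n m < minkowskiValue n m A * Real.log n := by
  have hk := kappa_pos hm hmn
  have hs : (0 : ℝ) < (rowSet A).card := by exact_mod_cast card_rowSet_pos hA
  have hN : (0 : ℝ) < A.card := by exact_mod_cast hA.card_pos
  have hJ := (Real.strictConcaveOn_rpow hk (kappa_lt_one hm hmn)).lt_map_sum
    (t := Finset.univ) (w := fun _ : rowSet A => ((rowSet A).card : ℝ)⁻¹)
    (p := fun j => (rowCount A j : ℝ)) (fun _ _ => by positivity)
    (by simp [hs.ne']) (fun _ _ => mem_Ici.mpr (Nat.cast_nonneg _))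
    ⟨j, Finset.mem_univ _, j', Finset.mem_univ _, by exact_mod_cast hjj'⟩
  simp only [smul_eq_mul, ← Finset.mul_sum, sum_rowCount] at hJ
  have hZ : ∑ j : rowSet A, (rowCount A j : ℝ) ^ kappa n m = rowPowerSum n m A := by
    refine Finset.sum_congr rfl fun j _ => ?_
    rw [← exp_logCount, ← Real.exp_mul, mul_comm]
  rw [hZ] at hJ
  have hZ1 := one_le_rowPowerSum (n := n) (m := m) hm hmn hA
  have hlog := Real.log_lt_log (by positivity) hJ
  rw [Real.log_mul (by positivity) (by positivity), Real.log_rpow (by positivity),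
    Real.log_mul (by positivity) (by positivity), Real.log_inv] at hlog
  rw [minkowskiValue_mul_log hm hmn, div_lt_iff₀ hk, add_mul, div_mul_cancel₀ _ hk.ne']
  linarith

end Hausdorff

lemma exists_card_lt_mul_rowCount {A : Finset (ℕ × ℕ)} {j j' : rowSet A}
    (hjj' : rowCount A j ≠ rowCount A j') :
    ∃ i : rowSet A, (A.card : ℝ) < (rowSet A).card * rowCount A i := by
  obtain ⟨i, -, hi⟩ := Finset.exists_max_image Finset.univ (fun j : rowSet A => rowCount A j)
    ⟨j, Finset.mem_univ j⟩
  refine ⟨i, ?_⟩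
  have hlt : ∃ k : rowSet A, rowCount A k < rowCount A i := by
    by_contra! h
    exact hjj' (((hi j (Finset.mem_univ j)).antisymm (h j)).trans
      ((hi j' (Finset.mem_univ j')).antisymm (h j')).symm)
  obtain ⟨k, hk⟩ := hlt
  rw [← sum_rowCount]
  calc ∑ j : rowSet A, (rowCount A j : ℝ) < ∑ _j : rowSet A, (rowCount A i : ℝ) :=
        Finset.sum_lt_sum (fun j _ => by exact_mod_cast hi j (Finset.mem_univ j))
          ⟨k, Finset.mem_univ k, by exact_mod_cast hk⟩
    _ = _ := by simp

lemma mem_rowSet_of_rowCount_pos {A : Finset (ℕ × ℕ)} {j : ℕ} (h : 1 ≤ rowCount A j) :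
    j ∈ rowSet A := by
  obtain ⟨a, ha⟩ := Finset.card_pos.mp h
  obtain ⟨h1, h2⟩ := Finset.mem_filter.mp ha
  exact Finset.mem_image.mpr ⟨a, h1, h2⟩

end BedfordMcMullen

/-- For `n > m ≥ 2` and non-empty `A` whose non-empty rows do not all have the
same cardinality, the carpet satisfies `dim_H S < dim_M S < dim_A S`. -/
theorem bm_dim_strict_inequalities (n m : ℕ) (hm : 2 ≤ m) (hmn : m < n)
    (A : Finset (ℕ × ℕ)) (hA : A.Nonempty)
    (hAsub : ∀ p ∈ A, p.1 < n ∧ p.2 < m)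
    (hnonunif : ∃ j j' : ℕ, 1 ≤ rowCount A j ∧ 1 ≤ rowCount A j' ∧
      rowCount A j ≠ rowCount A j') :
    dimH (bmCarpet n m A) < ENNReal.ofReal (upperMinkowskiDim (bmCarpet n m A)) ∧
    upperMinkowskiDim (bmCarpet n m A) < assouadDim (bmCarpet n m A) := by
  obtain ⟨j, j', hj, hj', hjj'⟩ := hnonunif
  lift j to BedfordMcMullen.rowSet A using BedfordMcMullen.mem_rowSet_of_rowCount_pos hj
  lift j' to BedfordMcMullen.rowSet A using BedfordMcMullen.mem_rowSet_of_rowCount_pos hj'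
  have hn : 0 < Real.log n := BedfordMcMullen.log_pos_of_two_le (by omega)
  rw [BedfordMcMullen.upperMinkowskiDim_eq hm hmn hA hAsub]
  constructor
  · obtain ⟨d, hd1, hd2⟩ := exists_between ((div_lt_iff₀ hn).mpr
      (BedfordMcMullen.log_rowPowerSum_div_lt hm hmn hA hjj'))
    rw [div_lt_iff₀ hn] at hd1
    have hd0 : 0 < d := by
      have h1 := div_nonneg (Real.log_nonneg (BedfordMcMullen.one_le_rowPowerSum hm hmn hA))
        (BedfordMcMullen.kappa_pos hm hmn).le
      exact pos_of_mul_pos_left (h1.trans_lt hd1) hn.le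
    have h := dimH_le_of_hausdorffMeasure_ne_top (d := d.toNNReal) (s := bmCarpet n m A) (by
      rw [Real.coe_toNNReal d hd0.le]
      exact BedfordMcMullen.hausdorffMeasure_ne_top hm hmn hA hAsub hd1)
    exact h.trans_lt ((ENNReal.ofReal_lt_ofReal_iff (hd0.trans hd2)).mpr hd2)
  · obtain ⟨i, hi⟩ := BedfordMcMullen.exists_card_lt_mul_rowCount hjj'
    refine lt_of_lt_of_le ?_ (BedfordMcMullen.le_assouadDim hm hmn hAsub i)
    have hs : ((BedfordMcMullen.rowSet A).card : ℝ) ≠ 0 := by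
      exact_mod_cast (BedfordMcMullen.card_rowSet_pos hA).ne'
    have ht : (rowCount A i : ℝ) ≠ 0 := by
      exact_mod_cast (BedfordMcMullen.rowCount_pos i).ne'
    have hlog := Real.log_lt_log (by exact_mod_cast hA.card_pos) hi
    rw [Real.log_mul hs ht] at hlog
    unfold BedfordMcMullen.minkowskiValue
    gcongr
    linarith
end
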